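/- arXiv:2108.03211 — 3 statements merged into one kernel-verified Lean document; each statement's English description precedes it below -/
import Mathlib

section
/- (Existence part of Theorem 2.7) Let G be a countably infinite group admitting a Følner sequence. Then there exists a multiorder on G, i.e. a Borel probability measure on {0,1}^{G×G} which is concentrated on the set Õ of orders of type ℤ on G and is invariant under the G-action a (g(≺)) b ⟺ ag ≺ bg. -/
open MeasureTheory Filter
open scoped Classical symmDiff

/-- An *order of type ℤ* on `G`. -/
def IsZOrder {G : Type*} (r : G → G → Prop) : Prop :=
  IsStrictTotalOrder G r ∧ (∀ a b : G, {g : G | r a g ∧ r g b}.Finite) ∧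
    (∀ a : G, ∃ b, r b a) ∧ (∀ a : G, ∃ b, r a b)

/-- The relation on `G` encoded by an element of `{0,1}^{G×G}`. -/
def relOf {G : Type*} (x : G × G → Bool) : G → G → Prop := fun a b => x (a, b) = true

/-- The set `Õ` of orders of type ℤ on `G`, as a subset of `{0,1}^{G×G}`. -/
def ZOrders (G : Type*) : Set (G × G → Bool) := {x | IsZOrder (relOf x)}

/-- The `G`-action on `{0,1}^{G×G}` corresponding to `a (g(≺)) b ⟺ ag ≺ bg`. -/
def actB {G : Type*} [Group G] (g : G) (x : G × G → Bool) : G × G → Bool :=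
  fun p => x (p.1 * g, p.2 * g)

/-- A Følner sequence in `G`. -/
def IsFolnerSeq {G : Type*} [Group G] (F : ℕ → Finset G) : Prop :=
  (∀ n, (F n).Nonempty) ∧ ∀ g : G,
    Tendsto (fun n => ((F n ∆ (F n).image (fun h => g * h)).card : ℝ) / (F n).card)
      atTop (nhds 0)


set_option linter.unusedSectionVars false

section Multiorder
variable {G : Type*} [Group G]

theorem mo_sum_count (A D X : Finset G) (hX : ∀ f ∈ D, ∀ h ∈ A, f⁻¹ * h ∈ X) :
    ∑ x ∈ X, (A.filter (fun h => h * x⁻¹ ∈ D)).card = A.card * D.card := by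
  simp only [Finset.card_filter]
  rw [Finset.sum_comm]
  have : ∀ h ∈ A, (∑ x ∈ X, if h * x⁻¹ ∈ D then 1 else 0) = D.card := by
    intro h hh
    rw [← Finset.card_filter]
    have : X.filter (fun x => h * x⁻¹ ∈ D) = D.image (fun f => f⁻¹ * h) := by
      ext x
      simp only [Finset.mem_filter, Finset.mem_image]
      constructor
      · rintro ⟨_, h2⟩
        exact ⟨_, h2, by group⟩
      · rintro ⟨f, hf, rfl⟩
        refine ⟨hX f hf h hh, ?_⟩
        simpa using hf
    rw [this, Finset.card_image_of_injective]
    intro a b hab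
    simpa using hab
  rw [Finset.sum_congr rfl this]
  simp

/-- the `K`-boundary count of `F`. -/
noncomputable def moBad (K F : Finset G) : ℕ :=
  ∑ g ∈ K, ((F.filter (fun f => g * f ∉ F)).card + (F.filter (fun f => g⁻¹ * f ∉ F)).card)

theorem mo_exists_piece (K F A : Finset G) (hFne : F.Nonempty) (ε : ℝ)
    (hF : (moBad K F : ℝ) ≤ ε * F.card) (hA : A.Nonempty) :
    ∃ x : G, (A.filter (fun h => h * x⁻¹ ∈ F)).Nonempty ∧
      ((∑ g ∈ K, ((A.filter (fun h => h * x⁻¹ ∈ F.filter (fun f => g * f ∉ F))).card +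
        (A.filter (fun h => h * x⁻¹ ∈ F.filter (fun f => g⁻¹ * f ∉ F))).card) : ℕ) : ℝ) ≤
        ε * (A.filter (fun h => h * x⁻¹ ∈ F)).card := by
  set X : Finset G := (F ×ˢ A).image (fun p => p.1⁻¹ * p.2) with hXdef
  have hX : ∀ f ∈ F, ∀ h ∈ A, f⁻¹ * h ∈ X := by
    intro f hf h hh
    exact Finset.mem_image.2 ⟨(f, h), Finset.mem_product.2 ⟨hf, hh⟩, rfl⟩
  have hXne : X.Nonempty := (hFne.product hA).image _
  have key : ∑ x ∈ X, ((∑ g ∈ K, ((A.filter (fun h => h * x⁻¹ ∈ F.filter (fun f => g * f ∉ F))).card +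
        (A.filter (fun h => h * x⁻¹ ∈ F.filter (fun f => g⁻¹ * f ∉ F))).card) : ℕ) : ℝ) ≤
        ∑ x ∈ X, ε * ((A.filter (fun h => h * x⁻¹ ∈ F)).card : ℝ) := by
    rw [← Finset.mul_sum, ← Nat.cast_sum, ← Nat.cast_sum, mo_sum_count A F X hX, Finset.sum_comm]
    simp only [Finset.sum_add_distrib]
    have h1 : ∀ g ∈ K, ∑ x ∈ X, (A.filter (fun h => h * x⁻¹ ∈ F.filter (fun f => g * f ∉ F))).card
        = A.card * (F.filter (fun f => g * f ∉ F)).card := fun g _ =>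
      mo_sum_count A _ X (fun f hf => hX f (Finset.mem_filter.1 hf).1)
    have h2 : ∀ g ∈ K, ∑ x ∈ X, (A.filter (fun h => h * x⁻¹ ∈ F.filter (fun f => g⁻¹ * f ∉ F))).card
        = A.card * (F.filter (fun f => g⁻¹ * f ∉ F)).card := fun g _ =>
      mo_sum_count A _ X (fun f hf => hX f (Finset.mem_filter.1 hf).1)
    rw [Finset.sum_congr rfl h1, Finset.sum_congr rfl h2, ← Finset.mul_sum, ← Finset.mul_sum,
      ← mul_add, ← Finset.sum_add_distrib]
    change ((A.card * moBad K F : ℕ) : ℝ) ≤ _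
    push_cast
    have : (0 : ℝ) ≤ A.card := by positivity
    nlinarith
  obtain ⟨x, hx, hle⟩ := Finset.exists_le_of_sum_le hXne key
  refine ⟨x, ?_, hle⟩
  obtain ⟨⟨f, h⟩, hp, rfl⟩ := Finset.mem_image.1 hx
  rw [Finset.mem_product] at hp
  exact ⟨h, Finset.mem_filter.2 ⟨hp.2, by simpa using hp.1⟩⟩

theorem mo_partition (K F : Finset G) (hFne : F.Nonempty) (ε : ℝ)
    (hF : (moBad K F : ℝ) ≤ ε * F.card) :
    ∀ (n : ℕ) (A : Finset G), A.card = n → ∃ c : G → G, (∀ h ∉ A, c h = h) ∧ (∀ h ∈ A, c h ∈ A) ∧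
      (∀ y : G, ∀ T : Finset G, (∀ t ∈ T, c t = y) → T.card ≤ F.card) ∧
      ((∑ g ∈ K, (A.filter (fun h => g * h ∈ A ∧ c (g * h) ≠ c h)).card : ℕ) : ℝ) ≤ ε * A.card := by
  intro n
  induction n using Nat.strong_induction_on with
  | _ n ih =>
  intro A hAn
  rcases A.eq_empty_or_nonempty with rfl | hA
  · refine ⟨id, by simp, by simp, ?_, by simp⟩
    intro y T hT
    have : T ⊆ {y} := fun t ht => by simpa using hT t ht
    exact (Finset.card_le_card this).trans (by simpa using hFne.card_pos)
  obtain ⟨x, hSne, hS⟩ := mo_exists_piece K F A hFne ε hF hA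
  set S := A.filter (fun h => h * x⁻¹ ∈ F) with hSdef
  have hSA : S ⊆ A := Finset.filter_subset _ _
  have hcard : (A \ S).card + S.card = A.card := Finset.card_sdiff_add_card_eq_card hSA
  have hSpos : 0 < S.card := hSne.card_pos
  obtain ⟨c, hc1, hc2, hc3, hc4⟩ := ih (A \ S).card (by omega) (A \ S) rfl
  obtain ⟨s, hs⟩ := hSne
  have hSF : S.card ≤ F.card := by
    refine Finset.card_le_card_of_injOn (fun h => h * x⁻¹) ?_ ?_
    · intro h hh
      exact (Finset.mem_filter.1 hh).2
    · intro a _ b _ hab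
      simpa using hab
  have hcS : ∀ h, h ∉ S → c h ∉ S := by
    intro h hh
    by_cases hA' : h ∈ A
    · exact (Finset.mem_sdiff.1 (hc2 h (Finset.mem_sdiff.2 ⟨hA', hh⟩))).2
    · rw [hc1 h (fun h' => hA' (Finset.mem_sdiff.1 h').1)]; exact hh
  refine ⟨fun h => if h ∈ S then s else c h, ?_, ?_, ?_, ?_⟩
  · intro h hh
    have h1 : h ∉ S := fun h' => hh (hSA h')
    simp only [h1, if_false]
    exact hc1 h (fun h' => hh (Finset.mem_sdiff.1 h').1)
  · intro h hh
    by_cases h1 : h ∈ S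
    · simp only [h1, if_true]; exact hSA hs
    · simp only [h1, if_false]
      exact (Finset.mem_sdiff.1 (hc2 h (Finset.mem_sdiff.2 ⟨hh, h1⟩))).1
  · intro y T hT
    by_cases hy : y ∈ S
    · refine (Finset.card_le_card (fun t ht => ?_)).trans hSF
      by_contra h1
      have := hT t ht
      simp only [h1, if_false] at this
      exact hcS t h1 (this ▸ hy)
    · refine hc3 y T (fun t ht => ?_)
      have := hT t ht
      by_cases h1 : t ∈ S
      · simp only [h1, if_true] at this
        exact absurd (this ▸ hs) hy
      · simpa only [h1, if_false] using this
  · have hle : ∑ g ∈ K, (A.filter (fun h => g * h ∈ A ∧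
        (if g * h ∈ S then s else c (g * h)) ≠ (if h ∈ S then s else c h))).card ≤
        ∑ g ∈ K, ((A \ S).filter (fun h => g * h ∈ A \ S ∧ c (g * h) ≠ c h)).card +
        ∑ g ∈ K, ((A.filter (fun h => h * x⁻¹ ∈ F.filter (fun f => g * f ∉ F))).card +
        (A.filter (fun h => h * x⁻¹ ∈ F.filter (fun f => g⁻¹ * f ∉ F))).card) := by
      rw [← Finset.sum_add_distrib]
      refine Finset.sum_le_sum (fun g _ => ?_)
      have h3 : (A.filter (fun h => h * x⁻¹ ∈ F.filter (fun f => g⁻¹ * f ∉ F))).card =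
          ((A.filter (fun h => h * x⁻¹ ∈ F.filter (fun f => g⁻¹ * f ∉ F))).image
            (fun h => g⁻¹ * h)).card := by
        rw [Finset.card_image_of_injective _ (mul_right_injective g⁻¹)]
      rw [h3]
      refine le_trans (Finset.card_le_card ?_) ((Finset.card_union_le _ _).trans
        (Nat.add_le_add_left (Finset.card_union_le _ _) _))
      intro h hh
      simp only [Finset.mem_filter, Finset.mem_union, Finset.mem_image, Finset.mem_sdiff] at hh ⊢
      obtain ⟨hhA, hgA, hne⟩ := hh
      by_cases h1 : h ∈ S
      · by_cases h2 : g * h ∈ S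
        · simp [h1, h2] at hne
        · right; left
          refine ⟨hhA, (Finset.mem_filter.1 h1).2, fun h4 => h2 (Finset.mem_filter.2 ⟨hgA, ?_⟩)⟩
          rwa [mul_assoc]
      · by_cases h2 : g * h ∈ S
        · right; right
          refine ⟨g * h, ⟨hgA, (Finset.mem_filter.1 h2).2, fun h4 => h1 (Finset.mem_filter.2 ⟨hhA, ?_⟩)⟩, ?_⟩
          · simpa [mul_assoc] using h4
          · simp
        · left
          simp only [h1, h2, if_false] at hne
          exact ⟨⟨hhA, h1⟩, ⟨hgA, h2⟩, hne⟩
    have hle' : ((∑ g ∈ K, (A.filter (fun h => g * h ∈ A ∧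
        (if g * h ∈ S then s else c (g * h)) ≠ (if h ∈ S then s else c h))).card : ℕ) : ℝ) ≤ _ :=
      Nat.cast_le.2 hle
    refine hle'.trans ?_
    rw [Nat.cast_add, ← hcard, Nat.cast_add, mul_add]
    exact add_le_add hc4 hS

theorem mo_folner_frac {F : ℕ → Finset G} (hF : IsFolnerSeq F) (g : G) :
    Tendsto (fun n => (((F n).filter (fun f => g * f ∉ F n)).card : ℝ) / (F n).card)
      atTop (nhds 0) := by
  refine squeeze_zero (fun n => by positivity) (fun n => ?_) (hF.2 g⁻¹)
  gcongr
  intro f hf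
  rw [Finset.mem_filter] at hf
  rw [Finset.mem_symmDiff]
  left
  refine ⟨hf.1, fun h => hf.2 ?_⟩
  obtain ⟨k, hk, rfl⟩ := Finset.mem_image.1 h
  simpa using hk

theorem mo_exists_folner {F : ℕ → Finset G} (hF : IsFolnerSeq F) (K : Finset G) (ε : ℝ)
    (hε : 0 < ε) : ∃ n, (moBad K (F n) : ℝ) ≤ ε * (F n).card := by
  have h1 : Tendsto (fun n => (moBad K (F n) : ℝ) / (F n).card) atTop (nhds 0) := by
    have : Tendsto (fun n => ∑ g ∈ K, ((((F n).filter (fun f => g * f ∉ F n)).card : ℝ) / (F n).card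
        + (((F n).filter (fun f => g⁻¹ * f ∉ F n)).card : ℝ) / (F n).card)) atTop
        (nhds (∑ g ∈ K, (0 + 0))) :=
      tendsto_finsetSum _ (fun g _ => (mo_folner_frac hF g).add (mo_folner_frac hF g⁻¹))
    simp only [add_zero, Finset.sum_const_zero] at this
    refine this.congr (fun n => ?_)
    simp only [moBad]
    push_cast
    rw [Finset.sum_div]
    simp only [add_div]
  obtain ⟨n, hn⟩ := (h1.eventually (gt_mem_nhds hε)).exists
  refine ⟨n, ?_⟩
  have : (0 : ℝ) < (F n).card := by exact_mod_cast (hF.1 n).card_pos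
  rw [div_lt_iff₀ this] at hn
  exact hn.le

/-- lexicographic relation built from labellings. -/
def moLex (e : G → ℕ) (c : ℕ → G → ℕ) : ℕ → G → G → Prop
  | 0 => fun a b => e a < e b
  | n + 1 => fun a b => c n a < c n b ∨ (c n a = c n b ∧ moLex e c n a b)

theorem moLex_irrefl (e : G → ℕ) (c : ℕ → G → ℕ) (n : ℕ) (a : G) : ¬ moLex e c n a a := by
  induction n with
  | zero => simp [moLex]
  | succ n ih => simp [moLex, ih]

theorem moLex_trans (e : G → ℕ) (c : ℕ → G → ℕ) (n : ℕ) (a b d : G) :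
    moLex e c n a b → moLex e c n b d → moLex e c n a d := by
  induction n with
  | zero => simp only [moLex]; exact lt_trans
  | succ n ih =>
    simp only [moLex]
    rintro (h1 | ⟨h1, h2⟩) (h3 | ⟨h3, h4⟩)
    · left; omega
    · left; omega
    · left; omega
    · right; exact ⟨by omega, ih h2 h4⟩

theorem moLex_total (e : G → ℕ) (he : Function.Injective e) (c : ℕ → G → ℕ) (n : ℕ) (a b : G) :
    moLex e c n a b ∨ a = b ∨ moLex e c n b a := by
  induction n with
  | zero =>
    simp only [moLex]
    rcases lt_trichotomy (e a) (e b) with h | h | h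
    · exact Or.inl h
    · exact Or.inr (Or.inl (he h))
    · exact Or.inr (Or.inr h)
  | succ n ih =>
    simp only [moLex]
    rcases lt_trichotomy (c n a) (c n b) with h | h | h
    · tauto
    · have := h.symm; tauto
    · tauto

theorem moLex_between (e : G → ℕ) (c : ℕ → G → ℕ) (n k : ℕ) (a b g : G)
    (hab : ∀ j, k ≤ j → j < n → c j a = c j b) (h1 : moLex e c n a g) (h2 : moLex e c n g b) :
    ∀ j, k ≤ j → j < n → c j g = c j a := by
  induction n with
  | zero => intro j _ hj; omega
  | succ n ih =>
    intro j hkj hj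
    have hn := hab n (by omega) (by omega)
    simp only [moLex] at h1 h2
    have h3 : c n g = c n a := by omega
    rcases Nat.lt_succ_iff_lt_or_eq.1 hj with h | rfl
    · refine ih (fun j h1 h2 => hab j h1 (by omega)) ?_ ?_ j hkj h
      · rcases h1 with h1 | h1
        · omega
        · exact h1.2
      · rcases h2 with h2 | h2
        · omega
        · exact h2.2
    · exact h3


theorem mo_geom (k n : ℕ) (h : k ≤ n) :
    ∑ j ∈ Finset.Ico k n, ((1 : ℝ) / 2) ^ j = 2 * (1 / 2) ^ k - 2 * (1 / 2) ^ n := by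
  induction n, h using Nat.le_induction with
  | base => simp
  | succ n hkn ih =>
    rw [Finset.sum_Ico_succ_top hkn, ih, pow_succ]
    ring

theorem mo_orders [Countable G] {F : ℕ → Finset G} (hF : IsFolnerSeq F) :
    ∃ r : ℕ → G → G → Prop, (∀ n a, ¬ r n a a) ∧ (∀ n a b d, r n a b → r n b d → r n a d) ∧
      (∀ n a b, r n a b ∨ a = b ∨ r n b a) ∧
      ∀ (a b : G) (ε : ℝ), 0 < ε → ∃ N : ℕ, ∀ᶠ n in atTop,
        (((F n).filter (fun h => ∃ T : Finset G, N < T.card ∧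
          ∀ t ∈ T, r n (a * h) t ∧ r n t (b * h))).card : ℝ) ≤ ε * (F n).card := by
  obtain ⟨e, he⟩ := exists_injective_nat G
  set K : ℕ → Finset G := fun j => (Finset.range (j + 1)).preimage e he.injOn with hK
  have hm : ∀ j, ∃ m, (moBad (K j) (F m) : ℝ) ≤ (1 / 2) ^ j * (F m).card := fun j =>
    mo_exists_folner hF (K j) _ (by positivity)
  choose m hm using hm
  have hc : ∀ j n, _ := fun j n => mo_partition (K j) (F (m j)) (hF.1 _) ((1 / 2) ^ j) (hm j) _ (F n) rfl
  choose c hc1 hc2 hc3 hc4 using hc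
  refine ⟨fun n => moLex e (fun j => e ∘ c j n) n, fun n => moLex_irrefl _ _ _,
    fun n => moLex_trans _ _ _, fun n => moLex_total _ he _ _, ?_⟩
  have hg : ∀ (g : G) (k n : ℕ), e g ≤ k → k ≤ n →
      (((F n).filter (fun h => g * h ∉ F n ∨ ∃ j ∈ Finset.Ico k n, g * h ∈ F n ∧
        c j n (g * h) ≠ c j n h)).card : ℝ) ≤
      ((F n).filter (fun h => g * h ∉ F n)).card + 2 * (1 / 2) ^ k * (F n).card := by
    intro g k n hgk hkn
    have h1 : (F n).filter (fun h => g * h ∉ F n ∨ ∃ j ∈ Finset.Ico k n, g * h ∈ F n ∧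
        c j n (g * h) ≠ c j n h) ⊆ (F n).filter (fun h => g * h ∉ F n) ∪
        (Finset.Ico k n).biUnion (fun j => (F n).filter (fun h => g * h ∈ F n ∧
          c j n (g * h) ≠ c j n h)) := by
      intro h hh
      simp only [Finset.mem_filter, Finset.mem_union, Finset.mem_biUnion] at hh ⊢
      rcases hh with ⟨h1, h2 | ⟨j, hj, h2⟩⟩
      · exact Or.inl ⟨h1, h2⟩
      · exact Or.inr ⟨j, hj, h1, h2⟩
    have h2 := (Finset.card_le_card h1).trans ((Finset.card_union_le _ _).trans
      (Nat.add_le_add_left Finset.card_biUnion_le _))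
    have h3 : ∀ j ∈ Finset.Ico k n, (((F n).filter (fun h => g * h ∈ F n ∧
          c j n (g * h) ≠ c j n h)).card : ℝ) ≤ (1 / 2) ^ j * (F n).card := by
      intro j hj
      refine le_trans ?_ (hc4 j n)
      rw [Nat.cast_le]
      refine Finset.single_le_sum (f := fun g => ((F n).filter (fun h => g * h ∈ F n ∧
          c j n (g * h) ≠ c j n h)).card) (fun _ _ => Nat.zero_le _) ?_
      rw [Finset.mem_Ico] at hj
      simp only [hK, Finset.mem_preimage, Finset.mem_range]
      omega
    have h4 := Finset.sum_le_sum h3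
    rw [← Finset.sum_mul, mo_geom k n hkn] at h4
    have h2' : (_ : ℝ) ≤ _ := Nat.cast_le.2 h2
    refine h2'.trans ?_
    push_cast
    refine add_le_add le_rfl (h4.trans ?_)
    gcongr
    have : (0 : ℝ) < (1 / 2) ^ n := by positivity
    linarith
  intro a b ε hε
  obtain ⟨k0, hk0⟩ := exists_pow_lt_of_lt_one (show 0 < ε / 8 by positivity)
    (show (1 / 2 : ℝ) < 1 by norm_num)
  set k := max k0 (max (e a) (e b)) with hk
  have hkε : ((1 : ℝ) / 2) ^ k ≤ ε / 8 :=
    (pow_le_pow_of_le_one (by norm_num) (by norm_num) (le_max_left _ _)).trans hk0.le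
  refine ⟨(F (m k)).card, ?_⟩
  have hε4 : 0 < ε / 4 := by positivity
  filter_upwards [eventually_gt_atTop k, (mo_folner_frac hF a).eventually (gt_mem_nhds hε4),
    (mo_folner_frac hF b).eventually (gt_mem_nhds hε4)] with n hn ha hb
  have hpos : (0 : ℝ) < (F n).card := by exact_mod_cast (hF.1 n).card_pos
  rw [div_lt_iff₀ hpos] at ha hb
  have hga := hg a k n (by simp [hk]) hn.le
  have hgb := hg b k n (by simp [hk]) hn.le
  have hsub : (F n).filter (fun h => ∃ T : Finset G, (F (m k)).card < T.card ∧
      ∀ t ∈ T, moLex e (fun j => e ∘ c j n) n (a * h) t ∧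
        moLex e (fun j => e ∘ c j n) n t (b * h)) ⊆
      (F n).filter (fun h => a * h ∉ F n ∨ ∃ j ∈ Finset.Ico k n, a * h ∈ F n ∧
        c j n (a * h) ≠ c j n h) ∪
      (F n).filter (fun h => b * h ∉ F n ∨ ∃ j ∈ Finset.Ico k n, b * h ∈ F n ∧
        c j n (b * h) ≠ c j n h) := by
    intro h hh
    rw [Finset.mem_filter] at hh
    obtain ⟨hhF, T, hT, hTT⟩ := hh
    rw [Finset.mem_union, Finset.mem_filter, Finset.mem_filter]
    by_contra hcon
    push Not at hcon
    have h1 := hcon.1 hhF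
    have h2 := hcon.2 hhF
    have hab : ∀ j, k ≤ j → j < n → (e ∘ c j n) (a * h) = (e ∘ c j n) (b * h) := by
      intro j hj hjn
      have hj' := Finset.mem_Ico.2 ⟨hj, hjn⟩
      simp only [Function.comp]
      rw [h1.2 j hj' h1.1, h2.2 j hj' h2.1]
    have := hc3 k n (c k n (a * h)) T (fun t ht => ?_)
    · omega
    · exact he (moLex_between e (fun j => e ∘ c j n) n k _ _ t hab (hTT t ht).1 (hTT t ht).2 k le_rfl hn)
  have h5 : (_ : ℝ) ≤ _ := Nat.cast_le.2 ((Finset.card_le_card hsub).trans (Finset.card_union_le _ _))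
  refine h5.trans ?_
  push_cast
  nlinarith

/-- empirical measure of an order along a finite set. -/
noncomputable def moEmp (A : Finset G) (x : G × G → Bool) : Measure (G × G → Bool) :=
  (A.card : ENNReal)⁻¹ • ∑ h ∈ A, Measure.dirac (actB h x)

theorem moEmp_apply (A : Finset G) (x : G × G → Bool) (s : Set (G × G → Bool))
    (hs : MeasurableSet s) :
    moEmp A x s = (A.card : ENNReal)⁻¹ * (A.filter (fun h => actB h x ∈ s)).card := by
  simp only [moEmp, Measure.smul_apply, Measure.finsetSum_apply, smul_eq_mul,
    Measure.dirac_apply' _ hs, Set.indicator_apply, Pi.one_apply]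
  rw [Finset.sum_boole]

theorem moEmp_prob (A : Finset G) (hA : A.Nonempty) (x : G × G → Bool) :
    IsProbabilityMeasure (moEmp A x) := by
  constructor
  rw [moEmp_apply _ _ _ MeasurableSet.univ]
  simp only [Set.mem_univ, Finset.filter_true]
  exact ENNReal.inv_mul_cancel (by simpa using hA.ne_empty) (by simp)

theorem moEmp_le (A : Finset G) (hA : A.Nonempty) (x : G × G → Bool) (s : Set (G × G → Bool))
    (hs : MeasurableSet s) (ε : ℝ) (h : ((A.filter (fun h => actB h x ∈ s)).card : ℝ) ≤ ε * A.card) :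
    moEmp A x s ≤ ENNReal.ofReal ε := by
  have hpos : (0 : ℝ) < A.card := by exact_mod_cast hA.card_pos
  rw [moEmp_apply _ _ _ hs, mul_comm, ← div_eq_mul_inv]
  refine ENNReal.div_le_of_le_mul ?_
  have := ENNReal.ofReal_le_ofReal h
  rwa [ENNReal.ofReal_mul' hpos.le, ENNReal.ofReal_natCast, ENNReal.ofReal_natCast] at this

theorem mo_integral (A : Finset G) (x : G × G → Bool) (f : (G × G → Bool) → ℝ)
    (hf : StronglyMeasurable f) :
    ∫ y, f y ∂(moEmp A x) = (∑ h ∈ A, f (actB h x)) / A.card := by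
  simp only [moEmp]
  rw [integral_smul_measure, integral_finsetSum_measure]
  · simp only [integral_dirac' _ _ hf]
    simp [div_eq_inv_mul]
  · intro h _
    exact (integrable_dirac' hf (by simp))

theorem mo_sum_diff (A : Finset G) (g : G) (φ : G → ℝ) (C : ℝ) (hφ : ∀ h, |φ h| ≤ C) :
    |∑ h ∈ A, φ (g * h) - ∑ h ∈ A, φ h| ≤ C * (A ∆ A.image (fun h => g * h)).card := by
  have h1 : ∑ h ∈ A, φ (g * h) = ∑ h ∈ A.image (fun h => g * h), φ h := by
    rw [Finset.sum_image]
    intro a _ b _ hab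
    simpa using hab
  rw [h1]
  set B := A.image (fun h => g * h)
  have h2 : ∑ h ∈ B, φ h - ∑ h ∈ A, φ h = ∑ h ∈ B \ A, φ h - ∑ h ∈ A \ B, φ h :=
    (Finset.sum_sdiff_sub_sum_sdiff).symm
  have h3 : ((A ∆ B).card : ℝ) = (A \ B).card + (B \ A).card := by
    rw [← Nat.cast_add]
    congr 1
    rw [symmDiff_def, Finset.sup_eq_union, Finset.card_union_of_disjoint]
    exact disjoint_sdiff_sdiff
  rw [h2, h3]
  have hs : ∀ D : Finset G, |∑ h ∈ D, φ h| ≤ C * D.card := by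
    intro D
    refine (Finset.abs_sum_le_sum_abs _ _).trans ((Finset.sum_le_sum (fun h _ => hφ h)).trans ?_)
    simp [mul_comm]
  have := abs_sub (∑ h ∈ B \ A, φ h) (∑ h ∈ A \ B, φ h)
  have a1 := hs (B \ A)
  have a2 := hs (A \ B)
  linarith

theorem actB_mul (g h : G) (x : G × G → Bool) : actB g (actB h x) = actB (g * h) x := by
  funext p
  simp [actB, mul_assoc]

theorem actB_cont (g : G) : Continuous (actB g) := by
  unfold actB
  fun_prop

end Multiorder

/-- Existence part of Theorem 2.7: on every countably infinite group admitting a Følner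
sequence there exists a multiorder, i.e. a Borel probability measure on `{0,1}^{G×G}`
concentrated on the set of orders of type ℤ and invariant under the `G`-action
`a (g(≺)) b ⟺ ag ≺ bg`. -/
theorem exists_multiorder {G : Type*} [Group G] [Countable G] [Infinite G]
    (hG : ∃ F : ℕ → Finset G, IsFolnerSeq F) :
    ∃ ν : Measure (G × G → Bool), IsProbabilityMeasure ν ∧ ν (ZOrders G) = 1 ∧
      ∀ g : G, Measure.map (actB g) ν = ν := by
  classical
  obtain ⟨F, hF⟩ := hG
  obtain ⟨r, hirr, htrans, htot, hint⟩ := mo_orders hF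
  set x : ℕ → (G × G → Bool) := fun n p => decide (r n p.1 p.2) with hx
  have hxr : ∀ n h a b, actB h (x n) (a, b) = true ↔ r n (a * h) (b * h) := by
    intro n h a b
    simp [actB, hx]
  set μ : ℕ → ProbabilityMeasure (G × G → Bool) := fun n =>
    ⟨moEmp (F n) (x n), moEmp_prob (F n) (hF.1 n) (x n)⟩ with hμ
  set U : Ultrafilter ℕ := Ultrafilter.of atTop with hU
  have hUle : (U : Filter ℕ) ≤ atTop := Ultrafilter.of_le atTop
  obtain ⟨ν, -, hν⟩ := isCompact_univ.ultrafilter_le_nhds (U.map μ) (by simp)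
  have hlim : Tendsto μ U (nhds ν) := hν
  -- open sets that are eventually small
  have hopen : ∀ (s : Set (G × G → Bool)) (ε : ℝ), IsOpen s →
      (∀ᶠ n in atTop, (((F n).filter (fun h => actB h (x n) ∈ s)).card : ℝ) ≤ ε * (F n).card) →
      (ν : Measure (G × G → Bool)) s ≤ ENNReal.ofReal ε := by
    intro s ε hs hev
    refine (ProbabilityMeasure.le_liminf_measure_open_of_tendsto hlim hs).trans ?_
    refine Filter.liminf_le_of_frequently_le' (Filter.Eventually.frequently ?_)
    filter_upwards [hUle hev] with n hn
    exact moEmp_le (F n) (hF.1 n) (x n) s hs.measurableSet ε hn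
  have hopen0 : ∀ (s : Set (G × G → Bool)), IsOpen s → (∀ n h, actB h (x n) ∉ s) →
      ∀ᵐ y ∂(ν : Measure (G × G → Bool)), y ∉ s := by
    intro s hs h0
    have := hopen s 0 hs (Eventually.of_forall fun n => by simp [h0])
    rw [ae_iff]
    simpa using this
  have hev : ∀ (p : G × G), Continuous (fun y : G × G → Bool => y p) := fun p => continuous_apply p
  have hop : ∀ (p : G × G) (v : Bool), IsOpen {y : G × G → Bool | y p = v} := fun p v =>
    (isOpen_discrete {v}).preimage (hev p)
  have c1 : ∀ᵐ y ∂(ν : Measure (G × G → Bool)), ∀ a : G, ¬ relOf y a a := by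
    rw [ae_all_iff]
    intro a
    refine hopen0 _ (hop (a, a) true) (fun n h => ?_)
    change ¬ (actB h (x n) (a, a) = true)
    rw [hxr]
    exact hirr _ _
  have c2 : ∀ᵐ y ∂(ν : Measure (G × G → Bool)), ∀ a b d : G,
      relOf y a b → relOf y b d → relOf y a d := by
    simp only [ae_all_iff]
    intro a b d
    have := hopen0 _ (((hop (a, b) true).inter (hop (b, d) true)).inter (hop (a, d) false))
      (fun n h => ?_)
    · filter_upwards [this] with y hy h1 h2
      by_contra h3
      exact hy ⟨⟨h1, h2⟩, by simpa [relOf] using h3⟩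
    · rintro ⟨⟨h1, h2⟩, h3⟩
      have h4 := (hxr n h a d).2 (htrans _ _ _ _ ((hxr n h a b).1 h1) ((hxr n h b d).1 h2))
      have h3' : actB h (x n) (a, d) = false := h3
      rw [h4] at h3'
      exact absurd h3' (by simp)
  have c3 : ∀ᵐ y ∂(ν : Measure (G × G → Bool)), ∀ a b : G,
      relOf y a b ∨ a = b ∨ relOf y b a := by
    simp only [ae_all_iff]
    intro a b
    by_cases hab : a = b
    · exact Eventually.of_forall fun y => Or.inr (Or.inl hab)
    have := hopen0 _ ((hop (a, b) false).inter (hop (b, a) false)) (fun n h => ?_)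
    · filter_upwards [this] with y hy
      by_contra h3
      push Not at h3
      exact hy ⟨by simpa [relOf] using h3.1, by simpa [relOf] using h3.2.2⟩
    · rintro ⟨h1, h2⟩
      have h1' : actB h (x n) (a, b) = false := h1
      have h2' : actB h (x n) (b, a) = false := h2
      rcases htot n (a * h) (b * h) with h3 | h3 | h3
      · rw [(hxr n h a b).2 h3] at h1'; exact absurd h1' (by simp)
      · exact hab (mul_right_cancel h3)
      · rw [(hxr n h b a).2 h3] at h2'; exact absurd h2' (by simp)
  have c4 : ∀ᵐ y ∂(ν : Measure (G × G → Bool)), ∀ a b : G,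
      {g : G | relOf y a g ∧ relOf y g b}.Finite := by
    simp only [ae_all_iff]
    intro a b
    rw [ae_iff]
    refine le_antisymm (ENNReal.le_of_forall_pos_le_add ?_) zero_le
    intro ε hε _
    rw [zero_add]
    obtain ⟨N, hN⟩ := hint a b ε (by exact_mod_cast hε)
    set s : Set (G × G → Bool) := ⋃ (T : Finset G) (_ : N < T.card),
      ⋂ t ∈ T, ({y | y (a, t) = true} ∩ {y | y (t, b) = true}) with hs
    have hso : IsOpen s := isOpen_iUnion fun T => isOpen_iUnion fun _ =>
      isOpen_biInter_finset fun t _ => (hop _ _).inter (hop _ _)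
    have := hopen s ε hso ?_
    · rw [ENNReal.ofReal_coe_nnreal] at this
      refine (measure_mono ?_).trans this
      intro y hy
      obtain ⟨T, hT1, hT2⟩ := Set.Infinite.exists_subset_card_eq hy (N + 1)
      simp only [hs, Set.mem_iUnion, Set.mem_iInter]
      exact ⟨T, by omega, fun t ht => hT1 ht⟩
    · filter_upwards [hN] with n hn
      refine le_trans ?_ hn
      rw [Nat.cast_le]
      refine Finset.card_le_card fun h hh => ?_
      rw [Finset.mem_filter] at hh ⊢
      refine ⟨hh.1, ?_⟩
      have hh2 := hh.2
      simp only [hs, Set.mem_iUnion, Set.mem_iInter] at hh2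
      obtain ⟨T, hT, hT2⟩ := hh2
      refine ⟨T.image (fun t => t * h), ?_, ?_⟩
      · rwa [Finset.card_image_of_injective _ (mul_left_injective h)]
      · intro t ht
        obtain ⟨t, ht', rfl⟩ := Finset.mem_image.1 ht
        exact ⟨(hxr _ _ _ _).1 (hT2 t ht').1, (hxr _ _ _ _).1 (hT2 t ht').2⟩
  have hinv : ∀ g : G, Measure.map (actB g) (ν : Measure (G × G → Bool)) = ν := by
    intro g
    have hm : Measurable (actB g) := (actB_cont g).measurable
    have : IsProbabilityMeasure (Measure.map (actB g) (ν : Measure (G × G → Bool))) :=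
      Measure.isProbabilityMeasure_map hm.aemeasurable
    refine ext_of_forall_integral_eq_of_IsFiniteMeasure fun f => ?_
    rw [integral_map hm.aemeasurable f.continuous.aestronglyMeasurable]
    have hT := ProbabilityMeasure.tendsto_iff_forall_integral_tendsto.1 hlim
    have t1 := hT f
    have t2 := hT (f.compContinuous ⟨actB g, actB_cont g⟩)
    refine tendsto_nhds_unique t2 ?_
    have hdiff : Tendsto (fun n => ∫ y, (f.compContinuous ⟨actB g, actB_cont g⟩) y ∂(μ n : Measure (G × G → Bool))
        - ∫ y, f y ∂(μ n : Measure (G × G → Bool))) U (nhds 0) := by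
      have h0 := ((hF.2 g).const_mul ‖f‖).mono_left hUle
      rw [mul_zero] at h0
      refine squeeze_zero_norm (fun n => ?_) h0
      have e1 : ∫ y, f y ∂(μ n : Measure (G × G → Bool)) = _ :=
        mo_integral (F n) (x n) f f.continuous.stronglyMeasurable
      have e2 : ∫ y, (f.compContinuous ⟨actB g, actB_cont g⟩) y ∂(μ n : Measure (G × G → Bool)) = _ :=
        mo_integral (F n) (x n) (f.compContinuous ⟨actB g, actB_cont g⟩)
          (f.compContinuous ⟨actB g, actB_cont g⟩).continuous.stronglyMeasurable
      rw [e1, e2, ← sub_div, Real.norm_eq_abs, abs_div, Nat.abs_cast, ← mul_div_assoc]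
      gcongr
      have := mo_sum_diff (F n) g (fun h => f (actB h (x n))) ‖f‖ (fun h => f.norm_coe_le_norm _)
      simpa [actB_mul] using this
    have := hdiff.add t1
    simpa using this
  have hmeas : ∀ p : G × G, MeasurableSet {y : G × G → Bool | ¬ y p = true} := fun p =>
    ((hop p true).measurableSet).compl
  -- no extreme element
  have hext : ∀ M : G → Set (G × G → Bool), (∀ a, MeasurableSet (M a)) →
      (∀ a g, actB g ⁻¹' M a = M (a * g)) →
      (∀ᵐ y ∂(ν : Measure (G × G → Bool)), ∀ a b, y ∈ M a → y ∈ M b → a = b) →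
      ∀ᵐ y ∂(ν : Measure (G × G → Bool)), ∀ a, y ∉ M a := by
    intro M hM hMg hMd
    have heq : ∀ a, (ν : Measure (G × G → Bool)) (M a) = (ν : Measure (G × G → Bool)) (M 1) := by
      intro a
      have h1 := Measure.map_apply (μ := (ν : Measure (G × G → Bool))) (actB_cont a).measurable (hM 1)
      rw [hinv a, hMg, one_mul] at h1
      exact h1.symm
    have hsum := tsum_meas_le_meas_iUnion_of_disjoint₀ (ν : Measure (G × G → Bool))
      (fun a => (hM a).nullMeasurableSet) (fun a b hab => by
        change (ν : Measure (G × G → Bool)) (M a ∩ M b) = 0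
        refine measure_mono_null ?_ hMd
        intro y hy hcon
        exact hab (hcon a b hy.1 hy.2))
    have hz : (ν : Measure (G × G → Bool)) (M 1) = 0 := by
      by_contra hne
      simp only [heq] at hsum
      rw [ENNReal.tsum_const_eq_top_of_ne_zero hne] at hsum
      exact measure_ne_top _ _ (top_le_iff.1 hsum)
    rw [ae_all_iff]
    intro a
    rw [ae_iff]
    simpa [heq a] using hz
  have c5 := hext (fun a => {y | ∀ b, ¬ y (b, a) = true})
    (fun a => by
      simp only [Set.ofPred_forall]
      exact MeasurableSet.iInter fun b => hmeas _)
    (fun a g => by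
      ext y
      simp only [Set.mem_preimage, Set.mem_ofPred_eq, actB]
      exact ⟨fun h b => by simpa using h (b * g⁻¹), fun h b => h _⟩)
    (by
      filter_upwards [c3] with y hy a b ha hb
      rcases hy a b with h | h | h
      · exact absurd h (hb a)
      · exact h
      · exact absurd h (ha b))
  have c6 := hext (fun a => {y | ∀ b, ¬ y (a, b) = true})
    (fun a => by
      simp only [Set.ofPred_forall]
      exact MeasurableSet.iInter fun b => hmeas _)
    (fun a g => by
      ext y
      simp only [Set.mem_preimage, Set.mem_ofPred_eq, actB]
      exact ⟨fun h b => by simpa using h (b * g⁻¹), fun h b => h _⟩)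
    (by
      filter_upwards [c3] with y hy a b ha hb
      rcases hy a b with h | h | h
      · exact absurd h (ha b)
      · exact h
      · exact absurd h (hb a))
  refine ⟨ν, inferInstance, ?_, hinv⟩
  have hall : ∀ᵐ y ∂(ν : Measure (G × G → Bool)), y ∈ ZOrders G := by
    filter_upwards [c1, c2, c3, c4, c5, c6] with y h1 h2 h3 h4 h5 h6
    refine ⟨{ trichotomous := ?_, irrefl := h1, trans := h2 }, h4, ?_, ?_⟩
    · intro a b hab hba
      rcases h3 a b with h | h | h
      · exact absurd h hab
      · exact h
      · exact absurd h hba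
    · intro a
      by_contra hcon
      exact h5 a (fun b hb => hcon ⟨b, hb⟩)
    · intro a
      by_contra hcon
      exact h6 a (fun b hb => hcon ⟨b, hb⟩)
  have : ZOrders G =ᵐ[(ν : Measure (G × G → Bool))] Set.univ := eventuallyEq_univ.2 hall
  rw [measure_congr this]
  exact measure_univ
end

section
/- (Corollary 3.3) Let G be a countably infinite group admitting a Følner sequence, acting measurably and measure-preservingly on a standard Borel probability space (X,μ), and assume the action is free in the measure-theoretic sense: for μ-almost every x, g·x ≠ x for every g ≠ e. Then there exist a multiorder on G, i.e. a G-invariant Borel probability measure ν on the space Õ of orders of type ℤ on G, and a measurable map φ : X → Õ such that the pushforward of μ under φ equals ν and, for every g ∈ G, φ(g·x) = g(φ(x)) for μ-almost every x. -/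
open MeasureTheory Filter
open scoped Classical symmDiff

lemma exhaust_aux {X : Type*} [MeasurableSpace X] (μ : Measure X) [IsFiniteMeasure μ]
    (P : Set X → Set X → Prop)
    (hsub : ∀ A B, P A B → B ⊆ A ∧ MeasurableSet B)
    (hrefl : ∀ A, MeasurableSet A → P A A)
    (hchain : ∀ A : ℕ → Set X, (∀ n, P (A n) (A (n+1))) → P (A 0) (⋂ n, A n))
    (hstep : ∀ A, MeasurableSet A → μ A ≠ 0 → ∃ B, P A B ∧ μ B < μ A) :
    ∃ N, P Set.univ N ∧ μ N = 0 := by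
  have htrans : ∀ A B C, P A B → P B C → P A C := by
    intro A B C h1 h2
    have hC := hrefl C (hsub _ _ h2).2
    have := hchain (fun n => if n = 0 then A else if n = 1 then B else C) (by
      intro n
      rcases n with _ | _ | n
      · simpa using h1
      · simpa using h2
      · simpa using hC)
    have e : (⋂ n : ℕ, (if n = 0 then A else if n = 1 then B else C)) = C := by
      apply Set.Subset.antisymm
      · exact (Set.iInter_subset _ 2).trans (by simp)
      · refine Set.subset_iInter fun n => ?_
        have hBC := (hsub _ _ h2).1
        have hAB := (hsub _ _ h1).1
        split_ifs
        · exact hBC.trans hAB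
        · exact hBC
        · exact subset_rfl
    rw [e] at this
    simpa using this
  have hnext : ∀ (A : {A : Set X // MeasurableSet A}) (k : ℕ),
      ∃ B : {A : Set X // MeasurableSet A}, P A.1 B.1 ∧
        ∀ C, P A.1 C → μ B.1 ≤ μ C + ENNReal.ofReal ((1/2)^k) := by
    intro A k
    have hlt : sInf {r | ∃ C, P A.1 C ∧ μ C = r} <
        sInf {r | ∃ C, P A.1 C ∧ μ C = r} + ENNReal.ofReal ((1/2)^k) := by
      apply ENNReal.lt_add_right
      · have : sInf {r | ∃ C, P A.1 C ∧ μ C = r} ≤ μ A.1 := sInf_le ⟨_, hrefl _ A.2, rfl⟩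
        exact (this.trans_lt (measure_lt_top μ _)).ne
      · simp
    obtain ⟨r, ⟨B, hB, rfl⟩, hr⟩ := sInf_lt_iff.1 hlt
    refine ⟨⟨B, (hsub _ _ hB).2⟩, hB, fun C hC => hr.le.trans ?_⟩
    gcongr
    exact sInf_le ⟨C, hC, rfl⟩
  choose nx hnx1 hnx2 using hnext
  let A : ℕ → {A : Set X // MeasurableSet A} := fun n =>
    Nat.rec ⟨Set.univ, MeasurableSet.univ⟩ (fun k B => nx B k) n
  have hA : ∀ n, A (n+1) = nx (A n) n := fun n => rfl
  have hP : ∀ n, P (A n).1 (A (n+1)).1 := fun n => by rw [hA]; exact hnx1 _ _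
  have hanti : Antitone (fun n => (A n).1) := antitone_nat_of_succ_le fun n => (hsub _ _ (hP n)).1
  have htail : ∀ k, P (A k).1 (⋂ n, (A n).1) := by
    intro k
    have := hchain (fun n => (A (n+k)).1) (fun n => by
      have := hP (n+k)
      rwa [show n + k + 1 = n + 1 + k by ring] at this)
    simp only [zero_add] at this
    convert this using 1
    apply Set.Subset.antisymm
    · exact Set.subset_iInter fun n => Set.iInter_subset _ (n+k)
    · exact Set.iInter_mono fun n => hanti (Nat.le_add_right n k)
  refine ⟨⋂ n, (A n).1, htail 0, ?_⟩
  by_contra h0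
  obtain ⟨B, hB, hlt⟩ := hstep _ (MeasurableSet.iInter fun n => (A n).2) h0
  refine absurd hlt (not_lt.2 ?_)
  have hle : ∀ k : ℕ, μ (⋂ n, (A n).1) ≤ μ B + ENNReal.ofReal ((1/2)^k) := by
    intro k
    refine (measure_mono (Set.iInter_subset _ (k+1))).trans ?_
    rw [hA]
    exact hnx2 _ _ _ (htrans _ _ _ (htail k) hB)
  have hlim : Tendsto (fun k : ℕ => μ B + ENNReal.ofReal ((1/2)^k)) atTop (nhds (μ B + 0)) := by
    refine Tendsto.const_add _ ?_
    rw [← ENNReal.ofReal_zero]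
    exact ENNReal.tendsto_ofReal (tendsto_pow_atTop_nhds_zero_of_lt_one (by norm_num) (by norm_num))
  rw [add_zero] at hlim
  exact ge_of_tendsto' hlim hle

/-- bad set -/
def badSet {G X : Type*} [Group G] [MulAction G X] (g : G) (A B : Set X) (u : X → ℝ) : Set X :=
  {x | x ∈ A ∧ g • x ∈ A ∧ ¬ (x ∈ B ∧ g • x ∈ B) ∧ ¬ (x ∉ B ∧ g • x ∉ B ∧ u (g • x) = u x)}

/-- descent relation -/
def Desc {G X : Type*} [Group G] [MulAction G X] [MeasurableSpace X] (μ : Measure X)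
    (K : Finset G) (ε : ENNReal) (A B : Set X) : Prop :=
  B ⊆ A ∧ MeasurableSet A ∧ MeasurableSet B ∧ ∃ u : X → ℝ, Measurable u ∧
    (∀ x ∈ A \ B, {g : G | g • x ∈ A \ B ∧ u (g • x) = u x}.Finite) ∧
    ∀ g ∈ K, μ (badSet g A B u) ≤ ε * μ (A \ B)

lemma Desc.chain {G X : Type*} [Group G] [MulAction G X] [MeasurableSpace X] {μ : Measure X}
    {K : Finset G} {ε : ENNReal} (A : ℕ → Set X)
    (h : ∀ n, Desc μ K ε (A n) (A (n+1))) : Desc μ K ε (A 0) (⋂ n, A n) := by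
  have hm : ∀ n, MeasurableSet (A n) := fun n => (h n).2.1
  have hanti : Antitone A := antitone_nat_of_succ_le fun n => (h n).1
  choose u hu hfin hbd using fun n => (h n).2.2.2
  have hex : ∀ x, ∃ n, x ∉ A (n+1) ∨ x ∈ ⋂ n, A n := by
    intro x
    by_cases hx : x ∈ ⋂ n, A n
    · exact ⟨0, Or.inr hx⟩
    · simp only [Set.mem_iInter, not_forall] at hx
      obtain ⟨n, hn⟩ := hx
      exact ⟨n, Or.inl fun h' => hn (hanti (Nat.le_succ n) h')⟩
  let N : X → ℕ := fun x => Nat.find (hex x)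
  have hN : Measurable N := measurable_find hex fun k =>
    ((hm (k+1)).compl.union (MeasurableSet.iInter hm))
  have hNA : ∀ x ∈ A 0 \ ⋂ n, A n, x ∈ A (N x) \ A (N x + 1) := by
    intro x hx
    constructor
    · rcases hk : N x with _ | k
      · exact hx.1
      · have := Nat.find_min (hex x) (m := k) (by change k < N x; omega)
        push Not at this
        exact this.1
    · exact (Nat.find_spec (hex x)).resolve_right hx.2
  have huniq : ∀ x n, x ∈ A n \ A (n+1) → N x = n := by
    intro x n hx
    have hx' : x ∈ A 0 \ ⋂ n, A n :=
      ⟨hanti (Nat.zero_le n) hx.1, fun h' => hx.2 (Set.mem_iInter.1 h' _)⟩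
    have h1 := hNA x hx'
    by_contra hne
    rcases lt_or_gt_of_ne hne with hl | hl
    · exact h1.2 (hanti hl hx.1)
    · exact hx.2 (hanti hl h1.1)
  let e := embeddingReal (ℕ × ℝ)
  have he := measurableEmbedding_embeddingReal (ℕ × ℝ)
  let v : X → ℝ := fun x => e (N x, u (N x) x)
  have hv : Measurable v := by
    refine he.measurable.comp (hN.prodMk ?_)
    have : Measurable (fun p : ℕ × X => u p.1 p.2) := measurable_from_prod_countable_right hu
    exact this.comp (hN.prodMk measurable_id)
  have hveq : ∀ x y, v x = v y ↔ N x = N y ∧ u (N x) x = u (N y) y := by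
    intro x y
    rw [← Prod.mk_inj]
    exact he.injective.eq_iff
  have hCsub : ∀ n, A n \ A (n+1) ⊆ A 0 \ ⋂ n, A n := fun n x hx =>
    ⟨hanti (Nat.zero_le n) hx.1, fun h' => hx.2 (Set.mem_iInter.1 h' _)⟩
  refine ⟨Set.iInter_subset _ 0, hm 0, MeasurableSet.iInter hm, v, hv, ?_, ?_⟩
  · intro x hx
    refine (hfin (N x) x (hNA x hx)).subset ?_
    rintro g ⟨hg, hvg⟩
    obtain ⟨h1, h2⟩ := (hveq _ _).1 hvg
    have := hNA _ hg
    rw [h1] at this h2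
    exact ⟨this, h2⟩
  · intro g hg
    have hU : A 0 \ ⋂ n, A n = ⋃ n, A n \ A (n+1) :=
      Set.Subset.antisymm (fun x hx => Set.mem_iUnion.2 ⟨_, hNA x hx⟩) (Set.iUnion_subset hCsub)
    have hdisj : Pairwise (Function.onFun Disjoint fun n => A n \ A (n+1)) := by
      intro i j hij
      rw [Function.onFun, Set.disjoint_left]
      intro x hi hj
      exact hij ((huniq x i hi).symm.trans (huniq x j hj))
    have hsub : badSet g (A 0) (⋂ n, A n) v ⊆ ⋃ n, badSet g (A n) (A (n+1)) (u n) := by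
      rintro x ⟨hx, hgx, h1, h2⟩
      have hor : x ∈ A 0 \ ⋂ n, A n ∨ g • x ∈ A 0 \ ⋂ n, A n := by
        by_contra hc
        push Not at hc
        simp only [Set.mem_sdiff, not_and, not_not] at hc
        exact h1 ⟨hc.1 hx, hc.2 hgx⟩
      have hexn : ∃ n, x ∈ A n \ A (n+1) ∨ g • x ∈ A n \ A (n+1) := by
        rcases hor with h | h
        · exact ⟨_, Or.inl (hNA _ h)⟩
        · exact ⟨_, Or.inr (hNA _ h)⟩
      have hspec := Nat.find_spec hexn
      have hmin := fun k => Nat.find_min hexn (m := k)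
      generalize Nat.find hexn = n at hspec hmin
      have hboth : x ∈ A n ∧ g • x ∈ A n := by
        have : ∀ k ≤ n, x ∈ A k ∧ g • x ∈ A k := by
          intro k
          induction k with
          | zero => exact fun _ => ⟨hx, hgx⟩
          | succ k ih =>
            intro hk
            have h3 := ih (by omega)
            have h4 := hmin k (by omega)
            simp only [Set.mem_sdiff, not_or, not_and, not_not] at h4
            exact ⟨h4.1 h3.1, h4.2 h3.2⟩
        exact this n le_rfl
      refine Set.mem_iUnion.2 ⟨n, hboth.1, hboth.2, ?_, ?_⟩
      · rintro ⟨h3, h4⟩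
        rcases hspec with h | h
        · exact h.2 h3
        · exact h.2 h4
      · rintro ⟨h3, h4, h5⟩
        have h6 : x ∈ A n \ A (n+1) := ⟨hboth.1, h3⟩
        have h7 : g • x ∈ A n \ A (n+1) := ⟨hboth.2, h4⟩
        refine h2 ⟨(hCsub n h6).2, (hCsub n h7).2, ?_⟩
        rw [hveq, huniq _ _ h6, huniq _ _ h7]
        exact ⟨rfl, h5⟩
    calc μ (badSet g (A 0) (⋂ n, A n) v) ≤ μ (⋃ n, badSet g (A n) (A (n+1)) (u n)) :=
          measure_mono hsub
      _ ≤ ∑' n, μ (badSet g (A n) (A (n+1)) (u n)) := measure_iUnion_le _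
      _ ≤ ∑' n, ε * μ (A n \ A (n+1)) := ENNReal.tsum_le_tsum fun n => hbd n g hg
      _ = ε * ∑' n, μ (A n \ A (n+1)) := ENNReal.tsum_mul_left
      _ = ε * μ (A 0 \ ⋂ n, A n) := by
        rw [hU, measure_iUnion hdisj fun n => (hm n).diff (hm (n+1))]

lemma Desc.refl {G X : Type*} [Group G] [MulAction G X] [MeasurableSpace X] {μ : Measure X}
    {K : Finset G} {ε : ENNReal} (A : Set X) (hA : MeasurableSet A) : Desc μ K ε A A := by
  refine ⟨subset_rfl, hA, hA, fun _ => 0, measurable_const, by simp, ?_⟩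
  intro g _
  have : badSet g A A (fun _ => 0) = ∅ := by
    ext x; simp only [badSet, Set.mem_ofPred_eq, Set.mem_empty_iff_false]; tauto
  simp [this]

lemma exists_sep {G X : Type*} [Group G] [MulAction G X] [MeasurableSpace X]
    [StandardBorelSpace X] [MeasurableConstSMul G X] (μ : Measure X) (L : Finset G)
    (B : Set X) (hB : MeasurableSet B) (hμ : μ B ≠ 0)
    (hfree : ∀ x ∈ B, ∀ g : G, g ≠ 1 → g • x ≠ x) :
    ∃ B' ⊆ B, MeasurableSet B' ∧ μ B' ≠ 0 ∧ ∀ z ∈ B', ∀ h ∈ L, h ≠ 1 → h • z ∉ B' := by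
  let ι := embeddingReal X
  have hι := measurableEmbedding_embeddingReal X
  let T : ℚ × ℚ → Set X := fun p =>
    B ∩ {z | ι z ∈ Set.Ioo (p.1 : ℝ) p.2 ∧ ∀ h ∈ L, h ≠ 1 → ι (h • z) ∉ Set.Ioo (p.1 : ℝ) p.2}
  have hTm : ∀ p, MeasurableSet (T p) := by
    intro p
    refine hB.inter (MeasurableSet.inter (hι.measurable measurableSet_Ioo) ?_)
    have : {z : X | ∀ h ∈ L, h ≠ 1 → ι (h • z) ∉ Set.Ioo (p.1 : ℝ) p.2} =
        ⋂ h ∈ L, ⋂ _ : h ≠ 1, (fun z => ι (h • z)) ⁻¹' (Set.Ioo (p.1 : ℝ) p.2)ᶜ := by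
      ext; simp
    change MeasurableSet {z : X | ∀ h ∈ L, h ≠ 1 → ι (h • z) ∉ Set.Ioo (p.1 : ℝ) p.2}
    rw [this]
    refine Finset.measurableSet_biInter _ fun h _ => MeasurableSet.iInter fun _ => ?_
    exact (hι.measurable.comp (measurable_const_smul h)) measurableSet_Ioo.compl
  have hcov : B ⊆ ⋃ p, T p := by
    intro z hz
    have hopen : (((L.filter (· ≠ 1)).image fun h => ι (h • z) : Finset ℝ) : Set ℝ)ᶜ ∈ nhds (ι z) := by
      refine (Finset.finite_toSet _).isClosed.isOpen_compl.mem_nhds ?_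
      simp only [Finset.coe_image, Set.mem_compl_iff, Set.mem_image, not_exists, not_and]
      intro h hh he
      have hh' : h ≠ 1 := by simpa using (Finset.mem_filter.1 (Finset.mem_coe.1 hh)).2
      exact hfree z hz h hh' (hι.injective he)
    obtain ⟨a, b, hab, hsub⟩ := mem_nhds_iff_exists_Ioo_subset.1 hopen
    obtain ⟨p, hp1, hp2⟩ := exists_rat_btwn hab.1
    obtain ⟨q, hq1, hq2⟩ := exists_rat_btwn hab.2
    refine Set.mem_iUnion.2 ⟨(p, q), hz, ⟨hp2, hq1⟩, ?_⟩
    intro h hh h1 hmem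
    have := hsub ⟨hp1.trans hmem.1, hmem.2.trans hq2⟩
    apply this
    simp only [Finset.coe_image, Set.mem_image]
    exact ⟨h, by simp [hh, h1], rfl⟩
  have : ∃ p, μ (T p) ≠ 0 := by
    by_contra hc
    push Not at hc
    exact hμ (measure_mono_null hcov (measure_iUnion_null hc))
  obtain ⟨p, hp⟩ := this
  exact ⟨T p, Set.inter_subset_left, hTm p, hp, fun z hz h hh h1 hm => hz.2.2 h hh h1 hm.2.1⟩

lemma Desc.step {G X : Type*} [Group G] [Countable G] [MulAction G X] [MeasurableSpace X]
    [StandardBorelSpace X] [MeasurableConstSMul G X] (μ : Measure X) [IsProbabilityMeasure μ]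
    [SMulInvariantMeasure G X μ]
    (hfree : ∀ᵐ x ∂μ, ∀ g : G, g ≠ 1 → g • x ≠ x)
    (hFol : ∃ F : ℕ → Finset G, IsFolnerSeq F) (K : Finset G) (ε : ℝ) (hε : 0 < ε)
    (A : Set X) (hA : MeasurableSet A) (hA0 : μ A ≠ 0) :
    ∃ B, Desc μ K (ENNReal.ofReal ε) A B ∧ μ B < μ A := by
  have hAt : μ A ≠ ⊤ := measure_ne_top μ A
  have hc0 : 0 < ε * ((μ A).toReal / 2) := by
    have := ENNReal.toReal_pos hA0 hAt
    positivity
  obtain ⟨F, hFne, hF⟩ : ∃ F : Finset G, F.Nonempty ∧ ∀ g ∈ K,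
      ((F ∆ F.image (fun h => g * h)).card : ℝ) ≤ ε * ((μ A).toReal / 2) * F.card := by
    obtain ⟨F, hne, hlim⟩ := hFol
    have : ∀ᶠ n in atTop, ∀ g ∈ K,
        ((F n ∆ (F n).image (fun h => g * h)).card : ℝ) / (F n).card < ε * ((μ A).toReal / 2) := by
      rw [eventually_all_finset]
      intro g _
      exact (hlim g).eventually_lt_const hc0
    obtain ⟨n, hn⟩ := this.exists
    refine ⟨F n, hne n, fun g hg => ?_⟩
    have hpos : (0 : ℝ) < (F n).card := by exact_mod_cast (hne n).card_pos
    exact ((div_lt_iff₀ hpos).1 (hn g hg)).le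
  -- counting function
  let n : X → ENNReal := fun z => ∑ f ∈ F, ((fun x => f • x) ⁻¹' A).indicator 1 z
  have hpre : ∀ (f : G) {S : Set X}, MeasurableSet S → MeasurableSet ((fun x => f • x) ⁻¹' S) :=
    fun f S hS => measurable_const_smul f hS
  have hnm : Measurable n := Finset.measurable_sum _ fun f _ => measurable_one.indicator (hpre f hA)
  have hnint : ∀ S, MeasurableSet S →
      ∫⁻ z in S, n z ∂μ = ∑ f ∈ F, μ ((fun x => f • x) ⁻¹' A ∩ S) := by
    intro S hS
    rw [lintegral_finsetSum _ fun f _ => measurable_one.indicator (hpre f hA)]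
    refine Finset.sum_congr rfl fun f _ => ?_
    rw [lintegral_indicator_one (hpre f hA), Measure.restrict_apply (hpre f hA)]
  have hcard0 : (F.card : ENNReal) ≠ 0 := by simpa using hFne.ne_empty
  let c : ENNReal := μ A / 2 * F.card
  have hBpos : μ {z | c ≤ n z} ≠ 0 := by
    intro h0
    have hae : ∀ᵐ z ∂μ, n z ≤ c := by
      have : ∀ᵐ z ∂μ, ¬ (c ≤ n z) := by rw [ae_iff]; simpa using h0
      filter_upwards [this] with z hz using (not_le.1 hz).le
    have h1 : ∫⁻ z, n z ∂μ ≤ c := by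
      calc ∫⁻ z, n z ∂μ ≤ ∫⁻ z, c ∂μ := lintegral_mono_ae hae
        _ = c := by simp
    have h2 := hnint Set.univ MeasurableSet.univ
    simp only [Measure.restrict_univ, Set.inter_univ, measure_preimage_smul, Finset.sum_const,
      nsmul_eq_mul] at h2
    rw [h2, mul_comm] at h1
    have h3 := (ENNReal.mul_le_mul_iff_left hcard0 (ENNReal.natCast_ne_top _)).1 h1
    exact absurd h3 (not_le.2 (ENNReal.half_lt_self hA0 hAt))
  let X0 : Set X := {x | ∀ g : G, g ≠ 1 → g • x ≠ x}
  have hX0 : MeasurableSet X0 := by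
    have : X0 = ⋂ g : G, ⋂ _ : g ≠ 1, {x | g • x = x}ᶜ := by ext; simp [X0]
    rw [this]
    exact MeasurableSet.iInter fun g => MeasurableSet.iInter fun _ =>
      (measurableSet_eq_fun (measurable_const_smul g) measurable_id).compl
  have hB1 : MeasurableSet ({z | c ≤ n z} ∩ X0) :=
    (measurableSet_le measurable_const hnm).inter hX0
  have hB1pos : μ ({z | c ≤ n z} ∩ X0) ≠ 0 := by
    have : μ ({z | c ≤ n z} ∩ X0) = μ {z | c ≤ n z} := by
      apply measure_congr
      exact inter_ae_eq_left_of_ae_eq_univ (eventuallyEq_univ.2 hfree)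
    rwa [this]
  obtain ⟨B, hBsub, hBm, hB0, hBsep⟩ := exists_sep μ
    ((F ×ˢ F).image fun p => p.2⁻¹ * p.1) _ hB1 hB1pos (fun x hx => hx.2)
  have hinj : ∀ f ∈ F, ∀ f' ∈ F, ∀ z ∈ B, ∀ z' ∈ B, f • z = f' • z' → f = f' ∧ z = z' := by
    intro f hf f' hf' z hz z' hz' h
    have hz2 : (f'⁻¹ * f) • z = z' := by rw [mul_smul, h, inv_smul_smul]
    by_cases h1 : f'⁻¹ * f = 1
    · refine ⟨?_, ?_⟩
      · rw [inv_mul_eq_one] at h1; exact h1.symm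
      · rw [h1, one_smul] at hz2; exact hz2
    · refine absurd (hz2 ▸ hz') (hBsep z hz _ ?_ h1)
      exact Finset.mem_image.2 ⟨(f, f'), by simp [hf, hf'], rfl⟩
  let W : G → Set X := fun f => (fun x => f⁻¹ • x) ⁻¹' B
  have hWm : ∀ f, MeasurableSet (W f) := fun f => hpre _ hBm
  have hWμ : ∀ f, μ (W f) = μ B := fun f => measure_preimage_smul μ _ _
  let C : Set X := ⋃ f ∈ F, A ∩ W f
  have hCm : MeasurableSet C := Finset.measurableSet_biUnion _ fun f _ => hA.inter (hWm f)
  have hCA : C ⊆ A := Set.iUnion₂_subset fun f _ => Set.inter_subset_left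
  have hdd : A \ (A \ C) = C := by
    ext x; simp only [Set.mem_sdiff]; have := @hCA x; tauto
  have hCx : ∀ x, x ∈ C ↔ x ∈ A ∧ ∃ f ∈ F, ∃ z ∈ B, x = f • z := by
    intro x
    simp only [C, W, Set.mem_iUnion, Set.mem_inter_iff, Set.mem_preimage]
    constructor
    · rintro ⟨f, hf, hxA, hx⟩
      exact ⟨hxA, f, hf, _, hx, by simp⟩
    · rintro ⟨hxA, f, hf, z, hz, rfl⟩
      exact ⟨f, hf, hxA, by simpa using hz⟩
  have hμC : c * μ B ≤ μ C := by
    have hd : (F : Set G).PairwiseDisjoint fun f => A ∩ W f := by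
      intro f hf f' hf' hne
      rw [Function.onFun, Set.disjoint_left]
      rintro x ⟨_, hx⟩ ⟨_, hx'⟩
      exact hne (hinj f hf f' hf' _ hx _ hx' (by simp)).1
    calc c * μ B = ∫⁻ z in B, c ∂μ := by simp
      _ ≤ ∫⁻ z in B, n z ∂μ := setLIntegral_mono hnm fun z hz => (hBsub hz).1
      _ = ∑ f ∈ F, μ ((fun x => f • x) ⁻¹' A ∩ B) := hnint B hBm
      _ = ∑ f ∈ F, μ (A ∩ W f) := by
        refine Finset.sum_congr rfl fun f _ => ?_
        rw [← measure_preimage_smul μ f (A ∩ W f)]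
        congr 1
        ext x; simp [W]
      _ = μ C := (measure_biUnion_finset hd fun f _ => hA.inter (hWm f)).symm
  have hc : c ≠ 0 := by
    simp only [c]
    refine mul_ne_zero ?_ hcard0
    exact (ENNReal.half_pos hA0).ne'
  have hC0 : μ C ≠ 0 := fun h => by
    rw [h] at hμC
    exact (mul_ne_zero hc hB0) (le_antisymm hμC bot_le)
  let ι := embeddingReal X
  have hι := measurableEmbedding_embeddingReal X
  let u : X → ℝ := fun y => ∑ f ∈ F, (W f).indicator (fun y => ι (f⁻¹ • y)) y
  have hum : Measurable u := Finset.measurable_sum _ fun f _ =>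
    (hι.measurable.comp (measurable_const_smul _)).indicator (hWm f)
  have hu : ∀ f ∈ F, ∀ z ∈ B, u (f • z) = ι z := by
    intro f hf z hz
    simp only [u]
    rw [Finset.sum_eq_single_of_mem f hf]
    · rw [Set.indicator_of_mem]
      · simp
      · simpa [W] using hz
    · intro f' hf' hne
      rw [Set.indicator_of_notMem]
      intro hm
      exact hne (hinj f hf f' hf' z hz _ hm (by simp)).1.symm
  refine ⟨A \ C, ⟨Set.sdiff_subset, hA, hA.diff hCm, u, hum, ?_, ?_⟩, ?_⟩
  · rw [hdd]
    intro x hx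
    obtain ⟨_, f, hf, z, hz, rfl⟩ := (hCx x).1 hx
    refine (F.image fun f' => f' * f⁻¹).finite_toSet.subset ?_
    rintro g ⟨hg, hgu⟩
    obtain ⟨_, f', hf', z', hz', he⟩ := (hCx _).1 hg
    rw [he, hu f' hf' z' hz', hu f hf z hz] at hgu
    have hzz : z' = z := hι.injective hgu
    subst hzz
    have h1 : (f'⁻¹ * (g * f)) • z' = z' := by
      rw [mul_smul, mul_smul, he, inv_smul_smul]
    have h2 : f'⁻¹ * (g * f) = 1 := by
      by_contra hne
      exact (hBsub hz).2 _ hne h1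
    rw [inv_mul_eq_one] at h2
    simp only [Finset.coe_image, Set.mem_image]
    exact ⟨f', hf', by rw [h2]; group⟩
  · intro g hg
    rw [hdd]
    have hsub : badSet g A (A \ C) u ⊆
        (⋃ f ∈ F.filter (fun f => g * f ∉ F), W f) ∪
        (⋃ f ∈ F.filter (fun f => g⁻¹ * f ∉ F), (fun x => g • x) ⁻¹' W f) := by
      rintro x ⟨hx, hgx, h1, h2⟩
      have hor : x ∈ C ∨ g • x ∈ C := by
        by_contra hh
        push Not at hh
        exact h1 ⟨⟨hx, hh.1⟩, ⟨hgx, hh.2⟩⟩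
      have key : ∀ f ∈ F, g * f ∈ F → ∀ z ∈ B, x = f • z → False := by
        rintro f hf hgf z hz rfl
        have hgz : g • f • z = (g * f) • z := (mul_smul g f z).symm
        refine h2 ⟨fun h => h.2 ((hCx _).2 ⟨hx, f, hf, z, hz, rfl⟩),
          fun h => h.2 ((hCx _).2 ⟨hgx, g * f, hgf, z, hz, hgz⟩), ?_⟩
        rw [hgz, hu _ hgf z hz, hu f hf z hz]
      rcases hor with h | h
      · obtain ⟨_, f, hf, z, hz, he⟩ := (hCx _).1 h
        left
        refine Set.mem_iUnion₂.2 ⟨f, Finset.mem_filter.2 ⟨hf, fun hgf => key f hf hgf z hz he⟩, ?_⟩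
        simpa [W, he] using hz
      · obtain ⟨_, f, hf, z, hz, he⟩ := (hCx _).1 h
        right
        refine Set.mem_iUnion₂.2 ⟨f, Finset.mem_filter.2 ⟨hf, fun hgf => ?_⟩, ?_⟩
        · refine key (g⁻¹ * f) hgf (by simpa using hf) z hz ?_
          rw [mul_smul, ← he, inv_smul_smul]
        · simpa [W, he] using hz
    have hcards : (F.filter (fun f => g * f ∉ F)).card + (F.filter (fun f => g⁻¹ * f ∉ F)).card
        ≤ (F ∆ F.image (fun h => g * h)).card := by
      rw [← Finset.card_image_of_injective (F.filter (fun f => g * f ∉ F)) (mul_right_injective g),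
        ← Finset.card_union_of_disjoint]
      · apply Finset.card_le_card
        intro y hy
        rw [Finset.mem_symmDiff]
        rcases Finset.mem_union.1 hy with hy | hy
        · obtain ⟨f, hf, rfl⟩ := Finset.mem_image.1 hy
          rw [Finset.mem_filter] at hf
          exact Or.inr ⟨Finset.mem_image.2 ⟨f, hf.1, rfl⟩, hf.2⟩
        · rw [Finset.mem_filter] at hy
          refine Or.inl ⟨hy.1, fun hh => ?_⟩
          obtain ⟨f, hf, rfl⟩ := Finset.mem_image.1 hh
          exact hy.2 (by simpa using hf)
      · rw [Finset.disjoint_left]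
        intro y hy hy'
        obtain ⟨f, hf, rfl⟩ := Finset.mem_image.1 hy
        exact (Finset.mem_filter.1 hf).2 (Finset.mem_filter.1 hy').1
    calc μ (badSet g A (A \ C) u) ≤ _ := measure_mono hsub
      _ ≤ _ := measure_union_le _ _
      _ ≤ (∑ f ∈ F.filter (fun f => g * f ∉ F), μ (W f)) +
          ∑ f ∈ F.filter (fun f => g⁻¹ * f ∉ F), μ ((fun x => g • x) ⁻¹' W f) :=
        add_le_add (measure_biUnion_finset_le _ _) (measure_biUnion_finset_le _ _)
      _ = (((F.filter (fun f => g * f ∉ F)).card + (F.filter (fun f => g⁻¹ * f ∉ F)).card : ℕ)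
          : ENNReal) * μ B := by
        simp only [measure_preimage_smul, hWμ, Finset.sum_const, nsmul_eq_mul]
        push_cast; ring
      _ ≤ ((F ∆ F.image (fun h => g * h)).card : ENNReal) * μ B := by
        gcongr
      _ ≤ (ENNReal.ofReal ε * c) * μ B := by
        gcongr
        have h1 := ENNReal.ofReal_le_ofReal (hF g hg)
        rw [ENNReal.ofReal_natCast] at h1
        refine h1.trans (le_of_eq ?_)
        rw [mul_assoc, ENNReal.ofReal_mul hε.le, ENNReal.ofReal_mul (by positivity),
          ENNReal.ofReal_natCast, ENNReal.ofReal_div_of_pos (by norm_num), ENNReal.ofReal_toReal hAt]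
        simp [c]
      _ ≤ ENNReal.ofReal ε * μ C := by
        rw [mul_assoc]; gcongr
  · rw [measure_sdiff hCA hCm.nullMeasurableSet (measure_ne_top _ _)]
    exact ENNReal.sub_lt_self hAt hA0 hC0

lemma exists_label {G X : Type*} [Group G] [Countable G] [MulAction G X] [MeasurableSpace X]
    [StandardBorelSpace X] [MeasurableConstSMul G X] (μ : Measure X) [IsProbabilityMeasure μ]
    [SMulInvariantMeasure G X μ]
    (hfree : ∀ᵐ x ∂μ, ∀ g : G, g ≠ 1 → g • x ≠ x)
    (hFol : ∃ F : ℕ → Finset G, IsFolnerSeq F) (K : Finset G) (ε : ℝ) (hε : 0 < ε) :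
    ∃ u : X → ℝ, Measurable u ∧ (∀ᵐ x ∂μ, {g : G | u (g • x) = u x}.Finite) ∧
      ∀ g ∈ K, μ {x | u (g • x) ≠ u x} ≤ ENNReal.ofReal ε := by
  obtain ⟨N, ⟨-, -, hNm, u, hu, hfin, hbd⟩, hN0⟩ :=
    exhaust_aux μ (Desc μ K (ENNReal.ofReal ε)) (fun A B h => ⟨h.1, h.2.2.1⟩)
    (fun A hA => Desc.refl A hA) (fun A h => Desc.chain A h)
    (fun A hA h0 => Desc.step μ hfree hFol K ε hε A hA h0)
  refine ⟨u, hu, ?_, ?_⟩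
  · have : ∀ᵐ x ∂μ, ∀ g : G, g • x ∉ N := by
      rw [ae_all_iff]
      intro g
      have h : μ ((fun x => g • x) ⁻¹' N) = 0 := by rw [measure_preimage_smul, hN0]
      exact measure_eq_zero_iff_ae_notMem.1 h
    filter_upwards [this] with x hx
    refine (hfin x ⟨trivial, by simpa using hx 1⟩).subset ?_
    intro g hg
    exact ⟨⟨trivial, hx g⟩, hg⟩
  · intro g hg
    have hsub : {x | u (g • x) ≠ u x} ⊆ badSet g Set.univ N u ∪ N := by
      intro x hx
      by_cases hxN : x ∈ N
      · exact Or.inr hxN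
      · exact Or.inl ⟨trivial, trivial, fun h => hxN h.1, fun h => hx h.2.2⟩
    calc _ ≤ μ (badSet g Set.univ N u ∪ N) := measure_mono hsub
      _ ≤ μ (badSet g Set.univ N u) + μ N := measure_union_le _ _
      _ ≤ ENNReal.ofReal ε * μ (Set.univ \ N) := by rw [hN0, add_zero]; exact hbd g hg
      _ ≤ ENNReal.ofReal ε * 1 := by gcongr; exact prob_le_one
      _ = _ := mul_one _

/-- Colexicographic comparison of real sequences. -/
def Colex' (s t : ℕ → ℝ) : Prop := ∃ k, s k < t k ∧ ∀ j, k < j → s j = t j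

lemma Colex'.irrefl (s : ℕ → ℝ) : ¬ Colex' s s := fun ⟨_, h, _⟩ => lt_irrefl _ h

lemma Colex'.trans {s t r : ℕ → ℝ} (h1 : Colex' s t) (h2 : Colex' t r) : Colex' s r := by
  obtain ⟨k, hk, hk'⟩ := h1
  obtain ⟨l, hl, hl'⟩ := h2
  rcases lt_trichotomy k l with h | h | h
  · exact ⟨l, by rw [hk' l h]; exact hl, fun j hj => (hk' j (h.trans hj)).trans (hl' j hj)⟩
  · subst h
    exact ⟨k, hk.trans hl, fun j hj => (hk' j hj).trans (hl' j hj)⟩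
  · exact ⟨k, by rw [← hl' k h]; exact hk, fun j hj => (hk' j hj).trans (hl' j (h.trans hj))⟩

lemma Colex'.tri {s t : ℕ → ℝ} (n : ℕ) (h : ∀ k ≥ n, s k = t k) :
    Colex' s t ∨ s = t ∨ Colex' t s := by
  induction n with
  | zero => exact Or.inr (Or.inl (funext fun k => h k (Nat.zero_le k)))
  | succ n ih =>
    rcases lt_trichotomy (s n) (t n) with h1 | h1 | h1
    · exact Or.inl ⟨n, h1, fun j hj => h j hj⟩
    · refine ih fun k hk => ?_
      rcases eq_or_lt_of_le hk with rfl | hk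
      · exact h1
      · exact h k hk
    · exact Or.inr (Or.inr ⟨n, h1, fun j hj => (h j hj).symm⟩)

lemma Colex'.between {s t r : ℕ → ℝ} (n : ℕ) (h : ∀ k ≥ n, s k = r k)
    (h1 : Colex' s t) (h2 : Colex' t r) : t n = s n := by
  obtain ⟨k, hk, hk'⟩ := h1
  obtain ⟨l, hl, hl'⟩ := h2
  by_cases hkn : k < n
  · exact (hk' n hkn).symm
  exfalso
  rw [not_lt] at hkn
  rcases lt_trichotomy k l with hh | rfl | hh
  · have := hk' l hh; have := h l (by omega); linarith
  · have := h k hkn; linarith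
  · have := hl' k hh; have := h k hkn; linarith

lemma measurableSet_colex {X : Type*} [MeasurableSpace X] {s t : X → ℕ → ℝ} (hs : Measurable s)
    (ht : Measurable t) : MeasurableSet {x | Colex' (s x) (t x)} := by
  have hs' := fun k => (measurable_pi_apply k).comp hs
  have ht' := fun k => (measurable_pi_apply k).comp ht
  have : {x | Colex' (s x) (t x)} = ⋃ k, ({x | s x k < t x k} ∩
      ⋂ j, ⋂ _ : k < j, {x | s x j = t x j}) := by
    ext x; simp [Colex']
  rw [this]
  exact MeasurableSet.iUnion fun k => (measurableSet_lt (hs' k) (ht' k)).inter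
    (MeasurableSet.iInter fun j => MeasurableSet.iInter fun _ => measurableSet_eq_fun (hs' j) (ht' j))

lemma null_of_transversal {G X : Type*} [Group G] [Countable G] [Infinite G] [MulAction G X]
    [MeasurableSpace X] [MeasurableConstSMul G X] (μ : Measure X) [IsProbabilityMeasure μ]
    [SMulInvariantMeasure G X μ] (M : Set X) (hM : MeasurableSet M)
    (h : ∀ᵐ x ∂μ, ∀ g k : G, g • x ∈ M → k • x ∈ M → g = k) :
    ∀ᵐ x ∂μ, ∀ g : G, g • x ∉ M := by
  have h0 : μ M = 0 := by
    by_contra hne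
    have hd : Pairwise (Function.onFun (AEDisjoint μ) fun g : G => (fun x : X => g • x) ⁻¹' M) := by
      intro g k hgk
      refine measure_eq_zero_iff_ae_notMem.2 ?_
      filter_upwards [h] with x hx
      exact fun hm => hgk (hx g k hm.1 hm.2)
    have h1 := measure_iUnion₀ hd fun g =>
      (measurable_const_smul g hM : MeasurableSet ((fun x : X => g • x) ⁻¹' M)).nullMeasurableSet
    simp only [measure_preimage_smul, ENNReal.tsum_const_eq_top_of_ne_zero hne] at h1
    exact measure_ne_top μ _ h1
  rw [ae_all_iff]
  intro g
  have h : μ ((fun x => g • x) ⁻¹' M) = 0 := by rw [measure_preimage_smul, h0]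
  exact measure_eq_zero_iff_ae_notMem.1 h

lemma exists_seq {G X : Type*} [Group G] [Countable G] [MulAction G X] [MeasurableSpace X]
    [StandardBorelSpace X] [MeasurableConstSMul G X] (μ : Measure X) [IsProbabilityMeasure μ]
    [SMulInvariantMeasure G X μ]
    (hfree : ∀ᵐ x ∂μ, ∀ g : G, g ≠ 1 → g • x ≠ x)
    (hFol : ∃ F : ℕ → Finset G, IsFolnerSeq F) :
    ∃ w : X → ℕ → ℝ, Measurable w ∧ ∀ᵐ x ∂μ,
      (∀ a b : G, w (a • x) = w (b • x) → a = b) ∧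
      (∀ a b : G, ∃ n, ∀ k ≥ n, w (a • x) k = w (b • x) k) ∧
      (∀ (a : G) (n : ℕ), {g : G | w (g • x) (n+1) = w (a • x) (n+1)}.Finite) := by
  obtain ⟨s, hs⟩ := exists_surjective_nat G
  choose u hum hufin hubd using fun n : ℕ => exists_label μ hfree hFol
    ((Finset.range (n+1)).image s) ((1/2)^n) (by positivity)
  have hι := measurableEmbedding_embeddingReal X
  refine ⟨fun x n => Nat.casesOn n (embeddingReal X x) (fun k => u k x), ?_, ?_⟩
  · refine measurable_pi_iff.2 fun n => ?_
    cases n with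
    | zero => exact hι.measurable
    | succ k => exact hum k
  have hev : ∀ᵐ x ∂μ, ∀ g : G, ∀ᶠ n in atTop, u n (g • x) = u n x := by
    rw [ae_all_iff]
    intro g
    obtain ⟨m, rfl⟩ := hs g
    have hsum : ∑' n, μ {x | u (n+m) (s m • x) ≠ u (n+m) x} ≠ ⊤ := by
      have hle : ∑' n, μ {x | u (n+m) (s m • x) ≠ u (n+m) x} ≤
          ∑' n : ℕ, ENNReal.ofReal ((1/2)^n) := by
        refine ENNReal.tsum_le_tsum fun n => ?_
        refine (hubd (n+m) (s m) ?_).trans (ENNReal.ofReal_le_ofReal ?_)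
        · exact Finset.mem_image.2 ⟨m, by simp, rfl⟩
        · exact pow_le_pow_of_le_one (by norm_num) (by norm_num) (by omega)
      refine ne_top_of_le_ne_top ?_ hle
      rw [← ENNReal.ofReal_tsum_of_nonneg (fun n => by positivity) summable_geometric_two]
      exact ENNReal.ofReal_ne_top
    filter_upwards [ae_eventually_notMem hsum] with x hx
    rw [← map_add_atTop_eq_nat m, eventually_map]
    filter_upwards [hx] with n hn
    by_contra hc
    exact hn hc
  have hfin : ∀ᵐ x ∂μ, ∀ (a : G) (n : ℕ), {g : G | u n (g • a • x) = u n (a • x)}.Finite := by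
    rw [ae_all_iff]
    intro a
    rw [ae_all_iff]
    intro n
    exact (measurePreserving_smul a μ).quasiMeasurePreserving.ae (hufin n)
  filter_upwards [hfree, hev, hfin] with x h1 h2 h3
  refine ⟨fun a b hab => ?_, fun a b => ?_, fun a n => ?_⟩
  · have h4 : a • x = b • x := hι.injective (congrFun hab 0)
    have h5 : (b⁻¹ * a) • x = x := by rw [mul_smul, h4, inv_smul_smul]
    by_contra hne
    exact h1 _ (fun h => hne (inv_mul_eq_one.1 h).symm) h5
  · obtain ⟨n, hn⟩ := eventually_atTop.1 ((h2 a).and (h2 b))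
    refine ⟨n+1, fun k hk => ?_⟩
    obtain ⟨k, rfl⟩ : ∃ l, k = l + 1 := ⟨k-1, by omega⟩
    have := hn k (by omega)
    exact this.1.trans this.2.symm
  · refine ((h3 a n).image fun g => g * a).subset ?_
    intro g hg
    refine ⟨g * a⁻¹, ?_, by simp⟩
    have : (g * a⁻¹) • a • x = g • x := by rw [smul_smul]; simp
    change u n ((g * a⁻¹) • a • x) = u n (a • x)
    rw [this]
    exact hg

/-- Corollary 3.3: every free measure-preserving action of a countably infinite group
admitting a Følner sequence, on a standard Borel probability space, has a multiorder as
a measure-theoretic factor: there are a `G`-invariant Borel probability measure `ν`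
concentrated on the orders of type ℤ and a measurable `φ : X → Õ` pushing `μ` to `ν`
which is almost-everywhere `G`-equivariant. -/
theorem free_action_has_multiorder_factor {G X : Type*} [Group G] [Countable G]
    [Infinite G] [MeasurableSpace X] [StandardBorelSpace X] [MulAction G X]
    (μ : Measure X) [IsProbabilityMeasure μ]
    (hmeas : ∀ g : G, Measurable (fun x : X => g • x))
    (hinv : ∀ g : G, Measure.map (fun x : X => g • x) μ = μ)
    (hfree : ∀ᵐ x ∂μ, ∀ g : G, g ≠ 1 → g • x ≠ x)
    (hFol : ∃ F : ℕ → Finset G, IsFolnerSeq F) :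
    ∃ (ν : Measure (G × G → Bool)) (φ : X → G × G → Bool),
      IsProbabilityMeasure ν ∧ ν (ZOrders G) = 1 ∧
      (∀ g : G, Measure.map (actB g) ν = ν) ∧
      Measurable φ ∧ Measure.map φ μ = ν ∧
      ∀ g : G, ∀ᵐ x ∂μ, φ (g • x) = actB g (φ x) := by

  have : MeasurableConstSMul G X := ⟨hmeas⟩
  have : SMulInvariantMeasure G X μ := ⟨fun g s hs => by
    rw [← Measure.map_apply (hmeas g) hs, hinv g]⟩
  obtain ⟨w, hw, hgood⟩ := exists_seq μ hfree hFol
  let φ : X → G × G → Bool := fun x p => decide (Colex' (w (p.1 • x)) (w (p.2 • x)))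
  have hwg : ∀ g : G, Measurable fun x => w (g • x) := fun g => hw.comp (hmeas g)
  have hφ : Measurable φ := by
    refine measurable_pi_iff.2 fun p => ?_
    refine measurable_to_bool ?_
    have : (fun x => φ x p) ⁻¹' {true} = {x | Colex' (w (p.1 • x)) (w (p.2 • x))} := by
      ext x; simp [φ]
    rw [this]
    exact measurableSet_colex (hwg _) (hwg _)
  have heq : ∀ (g : G) (x : X), φ (g • x) = actB g (φ x) := by
    intro g x
    ext p
    simp only [φ, actB, smul_smul]
  have hact : ∀ g : G, Measurable (actB g : (G × G → Bool) → _) := fun g =>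
    measurable_pi_iff.2 fun p => measurable_pi_apply _
  have hmin : ∀ᵐ x ∂μ, ∀ g : G, g • x ∉ {x | ∀ a : G, ¬ Colex' (w (a • x)) (w x)} := by
    refine null_of_transversal μ _ ?_ ?_
    · rw [Set.ofPred_forall]
      exact MeasurableSet.iInter fun a => (measurableSet_colex (hwg a) hw).compl
    · filter_upwards [hgood] with x hx g k hg hk
      have h1 := hg (k * g⁻¹)
      have h2 := hk (g * k⁻¹)
      simp only [smul_smul, inv_mul_cancel_right] at h1 h2
      obtain ⟨n, hn⟩ := hx.2.1 g k
      rcases Colex'.tri n hn with h | h | h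
      · exact absurd h h2
      · exact hx.1 _ _ h
      · exact absurd h h1
  have hmax : ∀ᵐ x ∂μ, ∀ g : G, g • x ∉ {x | ∀ a : G, ¬ Colex' (w x) (w (a • x))} := by
    refine null_of_transversal μ _ ?_ ?_
    · rw [Set.ofPred_forall]
      exact MeasurableSet.iInter fun a => (measurableSet_colex hw (hwg a)).compl
    · filter_upwards [hgood] with x hx g k hg hk
      have h1 := hg (k * g⁻¹)
      have h2 := hk (g * k⁻¹)
      simp only [smul_smul, inv_mul_cancel_right] at h1 h2
      obtain ⟨n, hn⟩ := hx.2.1 g k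
      rcases Colex'.tri n hn with h | h | h
      · exact absurd h h1
      · exact hx.1 _ _ h
      · exact absurd h h2
  have hZ : ∀ᵐ x ∂μ, φ x ∈ ZOrders G := by
    filter_upwards [hgood, hmin, hmax] with x hx h1 h2
    have hrel : ∀ a b, relOf (φ x) a b ↔ Colex' (w (a • x)) (w (b • x)) := by
      intro a b; simp [relOf, φ]
    refine ⟨?_, ?_, ?_, ?_⟩
    · exact
        { trichotomous := by
            intro a b hab hba
            rw [hrel] at hab hba
            obtain ⟨n, hn⟩ := hx.2.1 a b
            rcases Colex'.tri n hn with h | h | h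
            · exact absurd h hab
            · exact hx.1 _ _ h
            · exact absurd h hba
          irrefl := fun a h => Colex'.irrefl _ ((hrel a a).1 h)
          trans := fun a b c hab hbc => (hrel a c).2 (((hrel a b).1 hab).trans ((hrel b c).1 hbc)) }
    · intro a b
      obtain ⟨n, hn⟩ := hx.2.1 a b
      refine (hx.2.2 a n).subset ?_
      rintro g ⟨hag, hgb⟩
      exact Colex'.between (n+1) (fun k hk => hn k (by omega)) ((hrel _ _).1 hag) ((hrel _ _).1 hgb)
    · intro a
      have := h1 a
      simp only [Set.mem_ofPred_eq, not_forall, not_not, smul_smul] at this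
      obtain ⟨b, hb⟩ := this
      exact ⟨b * a, (hrel _ _).2 hb⟩
    · intro a
      have := h2 a
      simp only [Set.mem_ofPred_eq, not_forall, not_not, smul_smul] at this
      obtain ⟨b, hb⟩ := this
      exact ⟨b * a, (hrel _ _).2 hb⟩
  have hprob : IsProbabilityMeasure (Measure.map φ μ) :=
    Measure.isProbabilityMeasure_map hφ.aemeasurable
  refine ⟨Measure.map φ μ, φ, hprob, ?_, ?_, hφ, rfl, fun g => ae_of_all _ (heq g)⟩
  · refine le_antisymm prob_le_one ?_
    have h1 : μ (φ ⁻¹' ZOrders G) = 1 := by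
      exact (measure_congr (eventuallyEq_univ.2 hZ)).trans measure_univ
    rw [← h1]
    exact Measure.le_map_apply hφ.aemeasurable _
  · intro g
    have hcomp : actB g ∘ φ = φ ∘ fun x => g • x := by
      ext1 x; exact (heq g x).symm
    rw [Measure.map_map (hact g) hφ, hcomp, ← Measure.map_map hφ (hmeas g), hinv g]
end

section
/- (Theorem 3.5, factor part) Let G be a countably infinite group and define S̃ : Õ → Õ by S̃(≺) = g(≺), where g = bi_≺(1). Then: (a) for any set X with a G-action and any equivariant map φ : X → Õ, one has φ ∘ S = S̃ ∘ φ, where S(x) = bi_{φ(x)}(1)·x is the successor map; (b) for every multiorder ν on G (a G-invariant Borel probability measure on Õ), S̃ is measurable and preserves ν, i.e. the pushforward of ν under S̃ equals ν. -/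
open MeasureTheory
open scoped Classical

/-- `f : ℤ → G` is an anchored order isomorphism from `(ℤ,<)` to `(G,r)`. -/
def IsAnchoredIso {G : Type*} [One G] (r : G → G → Prop) (f : ℤ → G) : Prop :=
  Function.Bijective f ∧ f 0 = 1 ∧ ∀ i j : ℤ, i < j ↔ r (f i) (f j)

/-- The anchored bijection `bi_≺ : ℤ → G` associated with an order of type ℤ. -/
noncomputable def biOf {G : Type*} [One G] (r : G → G → Prop) : ℤ → G :=
  if h : ∃ f : ℤ → G, IsAnchoredIso r f then h.choose else fun _ => 1

/-- The successor map `S̃` on `Õ`: `S̃(≺) = g(≺)` where `g = 1^≺ = bi_≺(1)`. -/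
noncomputable def tildeS {G : Type*} [Group G] (x : G × G → Bool) : G × G → Bool :=
  actB (biOf (relOf x) 1) x

universe u

/-- `b` is the immediate successor of `a`. -/
def CovB {G : Type*} (x : G × G → Bool) (a b : G) : Prop :=
  x (a, b) = true ∧ ∀ h, ¬ (x (a, h) = true ∧ x (h, b) = true)

theorem exists_anchored {G : Type*} [Group G] (r : G → G → Prop) (hr : IsZOrder r) :
    ∃ f : ℤ → G, IsAnchoredIso r f := by
  obtain ⟨hst, hfin, hmin, hmax⟩ := hr
  let : LinearOrder G := linearOrderOfSTO r
  have hlt : ∀ a b : G, a < b ↔ r a b := fun a b => Iff.rfl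
  let : LocallyFiniteOrder G := LocallyFiniteOrder.ofFiniteIcc (fun a b => by
    refine Set.Finite.subset (((hfin a b).insert a).insert b) ?_
    rintro g ⟨h1, h2⟩
    rcases h1.eq_or_lt with rfl | h1
    · simp
    rcases h2.eq_or_lt with rfl | h2
    · simp
    exact Or.inr (Or.inr ⟨h1, h2⟩))
  have : NoMaxOrder G := ⟨hmax⟩
  have : NoMinOrder G := ⟨hmin⟩
  let : SuccOrder G := LinearLocallyFiniteOrder.succOrder G
  let : PredOrder G := LinearLocallyFiniteOrder.predOrder G
  let e : G ≃o ℤ := orderIsoIntOfLinearSuccPredArch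
  refine ⟨fun i => e.symm (i + e 1), ⟨?_, ?_⟩, by simp, ?_⟩
  · intro i j h
    simpa using h
  · intro g
    exact ⟨e g - e 1, by simp⟩
  · intro i j
    rw [← hlt, e.symm.lt_iff_lt]
    simp

theorem cov_iff {G : Type*} [Group G] (x : G × G → Bool) (f : ℤ → G)
    (hf : IsAnchoredIso (relOf x) f) (i j : ℤ) : CovB x (f i) (f j) ↔ j = i + 1 := by
  obtain ⟨hb, h0, hlt⟩ := hf
  have hlt' : ∀ i j, x (f i, f j) = true ↔ i < j := fun i j => (hlt i j).symm
  unfold CovB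
  rw [hb.surjective.forall]
  simp only [hlt']
  constructor
  · rintro ⟨h1, h2⟩
    have := h2 (i + 1)
    omega
  · rintro rfl
    exact ⟨by omega, fun h => by omega⟩

theorem biOf_spec {G : Type*} [Group G] {x : G × G → Bool} (hx : x ∈ ZOrders G) :
    IsAnchoredIso (relOf x) (biOf (relOf x)) := by
  have h := exists_anchored _ hx
  unfold biOf
  rw [dif_pos h]
  exact h.choose_spec

theorem biOf_one_iff {G : Type*} [Group G] {x : G × G → Bool} (hx : x ∈ ZOrders G) (g : G) :
    biOf (relOf x) 1 = g ↔ CovB x 1 g := by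
  have hs := biOf_spec hx
  obtain ⟨j, rfl⟩ := hs.1.surjective g
  have := cov_iff x _ hs 0 j
  rw [hs.2.1] at this
  rw [this, hs.1.injective.eq_iff]
  omega

theorem measurableSet_cov {G : Type*} [Countable G] (a b : G) :
    MeasurableSet {x : G × G → Bool | CovB x a b} := by
  have hm : ∀ p : G × G, MeasurableSet {x : G × G → Bool | x p = true} := fun p =>
    measurableSet_eq_fun (measurable_pi_apply p) measurable_const
  unfold CovB
  have h2 : MeasurableSet
      {x : G × G → Bool | ∀ h, ¬ (x (a, h) = true ∧ x (h, b) = true)} := by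
    rw [Set.ofPred_forall]
    exact MeasurableSet.iInter fun h => ((hm _).inter (hm _)).compl
  exact (hm _).inter h2

theorem measurableSet_ZOrders {G : Type*} [Countable G] : MeasurableSet (ZOrders G) := by
  have hm : ∀ p : G × G, MeasurableSet {x : G × G → Bool | x p = true} := fun p =>
    measurableSet_eq_fun (measurable_pi_apply p) measurable_const
  have heq : ZOrders G = {x : G × G → Bool |
      ((∀ a b, ¬ x (a, b) = true → ¬ x (b, a) = true → a = b) ∧ (∀ a, ¬ x (a, a) = true) ∧
        (∀ a b c, x (a, b) = true → x (b, c) = true → x (a, c) = true)) ∧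
      (∀ a b, ∃ F : Finset G, ∀ g, x (a, g) = true ∧ x (g, b) = true → g ∈ F) ∧
      (∀ a, ∃ b, x (b, a) = true) ∧ (∀ a, ∃ b, x (a, b) = true)} := by
    ext x
    refine and_congr ?_ (and_congr ?_ Iff.rfl)
    · constructor
      · intro h
        exact ⟨fun a b => h.trichotomous a b, fun a => h.irrefl a, fun a b c => h.trans a b c⟩
      · rintro ⟨h1, h2, h3⟩
        exact { trichotomous := h1, irrefl := h2, trans := h3 }
    · refine forall_congr' fun a => forall_congr' fun b => ?_
      constructor
      · intro h
        exact ⟨h.toFinset, fun g hg => h.mem_toFinset.2 hg⟩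
      · rintro ⟨F, hF⟩
        exact F.finite_toSet.subset hF
  rw [heq]
  have hi : ∀ {p q : (G × G → Bool) → Prop}, MeasurableSet {x | p x} → MeasurableSet {x | q x} →
      MeasurableSet {x | p x → q x} := by
    intro p q hp hq
    have : {x | p x → q x} = {x | p x}ᶜ ∪ {x | q x} := by
      ext x; simp [imp_iff_not_or]
    rw [this]
    exact hp.compl.union hq
  have ha : ∀ {ι : Type _} [Countable ι] {p : ι → (G × G → Bool) → Prop},
      (∀ i, MeasurableSet {x | p i x}) → MeasurableSet {x | ∀ i, p i x} := by
    intro ι _ p h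
    rw [Set.ofPred_forall]
    exact MeasurableSet.iInter h
  have he : ∀ {ι : Type _} [Countable ι] {p : ι → (G × G → Bool) → Prop},
      (∀ i, MeasurableSet {x | p i x}) → MeasurableSet {x | ∃ i, p i x} := by
    intro ι _ p h
    rw [Set.ofPred_exists]
    exact MeasurableSet.iUnion h
  refine MeasurableSet.inter (MeasurableSet.inter ?_ (MeasurableSet.inter ?_ ?_))
    (MeasurableSet.inter ?_ (MeasurableSet.inter ?_ ?_))
  · exact ha fun a => ha fun b => hi (hm _).compl (hi (hm _).compl (MeasurableSet.const _))
  · exact ha fun a => (hm _).compl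
  · exact ha fun a => ha fun b => ha fun c => hi (hm _) (hi (hm _) (hm _))
  · exact ha fun a => ha fun b => he fun F => ha fun g =>
      hi ((hm _).inter (hm _)) (MeasurableSet.const _)
  · exact ha fun a => he fun b => hm _
  · exact ha fun a => he fun b => hm _

theorem measurable_actB {G : Type*} [Group G] (g : G) : Measurable (actB g) :=
  measurable_pi_lambda _ fun _ => measurable_pi_apply _

theorem actB_mem {G : Type*} [Group G] (g : G) {x : G × G → Bool} (hx : x ∈ ZOrders G) :
    actB g x ∈ ZOrders G := by
  obtain ⟨h1, h2, h3, h4⟩ := hx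
  refine ⟨{ trichotomous := ?_, irrefl := ?_, trans := ?_ }, ?_, ?_, ?_⟩
  · intro a b ha hb
    exact mul_right_cancel (h1.trichotomous (a * g) (b * g) ha hb)
  · exact fun a => h1.irrefl (a * g)
  · exact fun a b c => h1.trans (a * g) (b * g) (c * g)
  · intro a b
    exact (h2 (a * g) (b * g)).preimage (f := fun c => c * g) (mul_left_injective g).injOn
  · intro a
    obtain ⟨b, hb⟩ := h3 (a * g)
    exact ⟨b * g⁻¹, by simpa [relOf, actB] using hb⟩
  · intro a
    obtain ⟨b, hb⟩ := h4 (a * g)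
    exact ⟨b * g⁻¹, by simpa [relOf, actB] using hb⟩

theorem actB_mem_iff {G : Type*} [Group G] (g : G) (x : G × G → Bool) :
    actB g x ∈ ZOrders G ↔ x ∈ ZOrders G := by
  refine ⟨fun h => ?_, actB_mem g⟩
  have := actB_mem g⁻¹ h
  have e : actB g⁻¹ (actB g x) = x := by
    funext p
    simp [actB]
  rwa [e] at this

theorem cov_actB {G : Type*} [Group G] (g : G) (x : G × G → Bool) (a b : G) :
    CovB (actB g x) a b ↔ CovB x (a * g) (b * g) := by
  unfold CovB actB
  refine and_congr Iff.rfl ?_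
  exact ⟨fun h c => by simpa using h (c * g⁻¹), fun h c => h (c * g)⟩

theorem preimage_tildeS {G : Type*} [Group G] (B : Set (G × G → Bool)) :
    ZOrders G ∩ tildeS ⁻¹' B =
      ⋃ g : G, actB g ⁻¹' (ZOrders G ∩ {y | CovB y g⁻¹ 1} ∩ B) := by
  ext x
  simp only [Set.mem_inter_iff, Set.mem_preimage, Set.mem_iUnion, actB_mem_iff, Set.mem_ofPred_eq,
    cov_actB, inv_mul_cancel, one_mul]
  constructor
  · rintro ⟨hx, hB⟩
    exact ⟨_, ⟨hx, (biOf_one_iff hx _).1 rfl⟩, hB⟩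
  · rintro ⟨g, ⟨hx, hc⟩, hB⟩
    refine ⟨hx, ?_⟩
    rw [← biOf_one_iff hx] at hc
    subst hc
    exact hB

theorem pred_unique {G : Type*} [Group G] {x : G × G → Bool} (hx : x ∈ ZOrders G) :
    ∃! g : G, CovB x g⁻¹ 1 := by
  have hs := biOf_spec hx
  have key := cov_iff x _ hs
  refine ⟨(biOf (relOf x) (-1))⁻¹, ?_, ?_⟩
  · have := key (-1) 0
    rw [hs.2.1] at this
    simpa using this
  · intro g hg
    obtain ⟨i, hi⟩ := hs.1.surjective g⁻¹
    have := key i 0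
    rw [hs.2.1, hi] at this
    have h := this.1 hg
    have : i = -1 := by omega
    rw [← this, hi, inv_inv]

/-- Theorem 3.5 (factor part): (a) for any `G`-action on `X` and any equivariant
`φ : X → Õ`, one has `φ ∘ S = S̃ ∘ φ` where `S` is the successor map on `X`;
(b) for every multiorder `ν` on `G`, the map `S̃` is measurable and preserves `ν`. -/
theorem tildeS_factor_and_preserves {G : Type*} [Group G] [Countable G] [Infinite G] :
    (∀ (X : Type u) [MulAction G X], ∀ φ : X → G × G → Bool, (∀ x : X, φ x ∈ ZOrders G) →
      (∀ (g : G) (x : X), φ (g • x) = actB g (φ x)) →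
      ∀ x : X, φ (biOf (relOf (φ x)) 1 • x) = tildeS (φ x)) ∧
    (∀ ν : Measure (G × G → Bool), IsProbabilityMeasure ν → ν (ZOrders G) = 1 →
      (∀ g : G, Measure.map (actB g) ν = ν) →
      Measurable (fun x : ZOrders G => tildeS (x : G × G → Bool)) ∧
        Measure.map tildeS ν = ν) := by
  refine ⟨fun X _ φ _ he x => he _ x, fun ν hν hZ hinv => ?_⟩
  have hZm : MeasurableSet (ZOrders G) := measurableSet_ZOrders
  have hae : ∀ᵐ x ∂ν, x ∈ ZOrders G := (mem_ae_iff_prob_eq_one hZm).2 hZ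
  have hC : ∀ B, MeasurableSet B → ∀ g : G,
      MeasurableSet (ZOrders G ∩ {y | CovB y g⁻¹ 1} ∩ B) := fun B hB g =>
    (hZm.inter (measurableSet_cov _ _)).inter hB
  have hpre : ∀ B, MeasurableSet B → MeasurableSet (ZOrders G ∩ tildeS ⁻¹' B) := by
    intro B hB
    rw [preimage_tildeS]
    exact MeasurableSet.iUnion fun g => measurable_actB g (hC B hB g)
  have hmeas : Measurable (fun x : ZOrders G => tildeS (x : G × G → Bool)) := by
    intro B hB
    refine ⟨_, hpre B hB, ?_⟩
    ext x
    simp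
  refine ⟨hmeas, ?_⟩
  have haem : AEMeasurable (tildeS (G := G)) ν := by
    have h1 : AEMeasurable (tildeS (G := G)) (ν.restrict (ZOrders G)) :=
      aemeasurable_restrict_of_measurable_subtype hZm hmeas
    rwa [Measure.restrict_eq_self_of_ae_mem hae] at h1
  have hdrop : ∀ B, ν (ZOrders G ∩ B) = ν B := by
    intro B
    refine measure_congr ?_
    filter_upwards [hae] with x hx
    exact propext ⟨fun h => h.2, fun h => ⟨hx, h⟩⟩
  have hdisj : ∀ B : Set (G × G → Bool), Pairwise (Function.onFun Disjoint
      fun g : G => ZOrders G ∩ {y | CovB y g⁻¹ 1} ∩ B) := by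
    intro B g h hgh
    refine Set.disjoint_left.2 ?_
    rintro x ⟨⟨hx, h1⟩, _⟩ ⟨⟨_, h2⟩, _⟩
    exact hgh ((pred_unique hx).unique h1 h2)
  ext B hB
  rw [Measure.map_apply_of_aemeasurable haem hB, ← hdrop, preimage_tildeS, measure_iUnion]
  · have h1 : ∀ g : G, ν (actB g ⁻¹' (ZOrders G ∩ {y | CovB y g⁻¹ 1} ∩ B)) =
        ν (ZOrders G ∩ {y | CovB y g⁻¹ 1} ∩ B) := by
      intro g
      rw [← Measure.map_apply (measurable_actB g) (hC B hB g), hinv]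
    simp_rw [h1]
    rw [← measure_iUnion (hdisj B) (hC B hB), ← hdrop B]
    congr 1
    ext x
    simp only [Set.mem_iUnion, Set.mem_inter_iff, Set.mem_ofPred_eq]
    constructor
    · rintro ⟨g, ⟨hx, _⟩, hB⟩
      exact ⟨hx, hB⟩
    · rintro ⟨hx, hB⟩
      obtain ⟨g, hg, _⟩ := pred_unique hx
      exact ⟨g, ⟨hx, hg⟩, hB⟩
  · intro g h hgh
    refine Set.disjoint_left.2 ?_
    rintro x ⟨⟨hx, h1⟩, _⟩ ⟨⟨_, h2⟩, _⟩
    rw [actB_mem_iff] at hx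
    simp only [Set.mem_ofPred_eq, cov_actB, inv_mul_cancel, one_mul] at h1 h2
    rw [← biOf_one_iff hx] at h1 h2
    exact hgh (h1.symm.trans h2)
  · exact fun g => measurable_actB g (hC B hB g)
end
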